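/- Let 𝒫 be the subalgebra of 𝒪_q(Mat_{2n}) generated by the elements x_{ij} := Σ_{k=1}^{n} (t_{i,2k−1} t_{j,2k} − q t_{i,2k} t_{j,2k−1}) (1 ≤ i,j ≤ 2n). The ordered monomials x_{12}^{m_{12}} x_{13}^{m_{13}} ⋯ x_{1,2n}^{m_{1,2n}} x_{23}^{m_{23}} x_{24}^{m_{24}} ⋯ x_{2,2n}^{m_{2,2n}} ⋯ x_{2n−1,2n}^{m_{2n−1,2n}}, in which the factors x_{ij} with i < j appear in lexicographic order of (i,j) and the exponents m_{ij} range over the nonnegative integers, form a k-vector-space basis of 𝒫; the monomials with the factors in the reversed order also form a k-basis of 𝒫. -/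

import Mathlib

open scoped BigOperators TensorProduct

set_option linter.unusedSimpArgs false
noncomputable section

abbrev K : Type := RatFunc ℂ

def q : K := RatFunc.X

/-- the generator `t_{ij}` of the free algebra -/
def Tg {n : ℕ} (i j : Fin n) : FreeAlgebra K (Fin n × Fin n) := FreeAlgebra.ι K (i, j)

/-- defining relations of `𝒪_q(Mat_n)` -/
inductive matRel (n : ℕ) :
    FreeAlgebra K (Fin n × Fin n) → FreeAlgebra K (Fin n × Fin n) → Prop
  | rowq (l i j : Fin n) (h : i < j) :
      matRel n (Tg l i * Tg l j) (q • (Tg l j * Tg l i))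
  | colq (l i j : Fin n) (h : i < j) :
      matRel n (Tg i l * Tg j l) (q • (Tg j l * Tg i l))
  | anti (i k j l : Fin n) (h1 : i < k) (h2 : j < l) :
      matRel n (Tg i l * Tg k j) (Tg k j * Tg i l)
  | main (i k j l : Fin n) (h1 : i < k) (h2 : j < l) :
      matRel n (Tg i j * Tg k l) (Tg k l * Tg i j + (q - q⁻¹) • (Tg k j * Tg i l))

/-- the quantized function algebra `𝒪_q(Mat_n)` -/
abbrev OqMat (n : ℕ) := RingQuot (matRel n)

/-- the generator `t_{ij}` of `𝒪_q(Mat_n)` -/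
def tGen {n : ℕ} (i j : Fin n) : OqMat n :=
  RingQuot.mkAlgHom K (matRel n) (Tg i j)

/-- the odd column index `2k-1` (1-based), i.e. `2k` (0-based) -/
def c1 (n : ℕ) (k : Fin n) : Fin (2 * n) := ⟨2 * (k : ℕ), by have := k.isLt; omega⟩

/-- the even column index `2k` (1-based), i.e. `2k+1` (0-based) -/
def c2 (n : ℕ) (k : Fin n) : Fin (2 * n) := ⟨2 * (k : ℕ) + 1, by have := k.isLt; omega⟩

/-- the Type AII quantum skew-symmetric matrix generators -/
def xAII (n : ℕ) (i j : Fin (2 * n)) : OqMat (2 * n) :=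
  ∑ k : Fin n, (tGen i (c1 n k) * tGen j (c2 n k) - q • (tGen i (c2 n k) * tGen j (c1 n k)))

/-- list of strictly upper-triangular index pairs `(i,j)`, `i < j`, in lexicographic order -/
def pairListAII (n : ℕ) : List (Fin (2 * n) × Fin (2 * n)) :=
  (List.finRange (2 * n)).flatMap fun i =>
    ((List.finRange (2 * n)).filter fun j => decide (i < j)).map fun j => (i, j)

/-- the ordered monomial `x_{12}^{m_{12}} x_{13}^{m_{13}} ⋯ x_{2n-1,2n}^{m_{2n-1,2n}}` -/
def monoAII (n : ℕ) (m : {p : Fin (2 * n) × Fin (2 * n) // p.1 < p.2} → ℕ) : OqMat (2 * n) :=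
  ((pairListAII n).map fun p => xAII n p.1 p.2 ^ (if h : p.1 < p.2 then m ⟨p, h⟩ else 0)).prod

/-- the ordered monomial with the factors in the reversed order -/
def monoAIIrev (n : ℕ) (m : {p : Fin (2 * n) × Fin (2 * n) // p.1 < p.2} → ℕ) : OqMat (2 * n) :=
  ((pairListAII n).reverse.map fun p =>
    xAII n p.1 p.2 ^ (if h : p.1 < p.2 then m ⟨p, h⟩ else 0)).prod

lemma q_ne_zero : q ≠ 0 := RatFunc.X_ne_zero

section Straightening

variable {F ι κ B : Type*} [Field F] [LinearOrder ι] [LinearOrder κ] [Ring B] [Algebra F B]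

/-- The matrix `T` satisfies the defining relations of a quantum matrix with parameter `s`. -/
structure IsQMat (s : F) (T : ι → κ → B) : Prop where
  row : ∀ l {i j}, i < j → T l i * T l j = s • (T l j * T l i)
  col : ∀ l {i j}, i < j → T i l * T j l = s • (T j l * T i l)
  anti : ∀ {i k j l}, i < k → j < l → T i l * T k j = T k j * T i l
  main : ∀ {i k j l}, i < k → j < l →
    T i j * T k l = T k l * T i j + (s - s⁻¹) • (T k j * T i l)

/-- The quantum `2 × 2` minor with rows `i, j` and columns `a, b`. -/
def qMinor (s : F) (T : ι → κ → B) (i j : ι) (a b : κ) : B :=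
  T i a * T j b - s • (T i b * T j a)

namespace IsQMat

variable {s : F} {T : ι → κ → B} {i j k l : ι} {a b c d : κ}

lemma row_swap (h : IsQMat s T) (hs : s ≠ 0) (l : ι) (hab : a < b) :
    T l b * T l a = s⁻¹ • (T l a * T l b) := by
  rw [h.row l hab, smul_smul, inv_mul_cancel₀ hs, one_smul]

lemma col_swap (h : IsQMat s T) (hs : s ≠ 0) (l : κ) (hij : i < j) :
    T j l * T i l = s⁻¹ • (T i l * T j l) := by
  rw [h.col l hij, smul_smul, inv_mul_cancel₀ hs, one_smul]

lemma main_swap (h : IsQMat s T) (hij : i < j) (hab : a < b) :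
    T j b * T i a = T i a * T j b - (s - s⁻¹) • (T i b * T j a) := by
  rw [h.main hij hab, h.anti hij hab]; abel

lemma row_swap_assoc (h : IsQMat s T) (hs : s ≠ 0) (l : ι) (hab : a < b) (z : B) :
    T l b * (T l a * z) = s⁻¹ • (T l a * (T l b * z)) := by
  rw [← mul_assoc, h.row_swap hs l hab, smul_mul_assoc, mul_assoc]

lemma col_swap_assoc (h : IsQMat s T) (hs : s ≠ 0) (l : κ) (hij : i < j) (z : B) :
    T j l * (T i l * z) = s⁻¹ • (T i l * (T j l * z)) := by
  rw [← mul_assoc, h.col_swap hs l hij, smul_mul_assoc, mul_assoc]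

lemma anti_assoc (h : IsQMat s T) (hij : i < j) (hab : a < b) (z : B) :
    T j a * (T i b * z) = T i b * (T j a * z) := by
  rw [← mul_assoc, ← h.anti hij hab, mul_assoc]

lemma main_swap_assoc (h : IsQMat s T) (hij : i < j) (hab : a < b) (z : B) :
    T j b * (T i a * z) = T i a * (T j b * z) - (s - s⁻¹) • (T i b * (T j a * z)) := by
  rw [← mul_assoc, h.main_swap hij hab, sub_mul, smul_mul_assoc, mul_assoc, mul_assoc]

lemma pair_common_first_same (h : IsQMat s T) (hs : s ≠ 0) (hij : i < j) (hjk : j < k) (hab : a < b) :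
    qMinor s T i j a b * qMinor s T i k a b =
      s • (qMinor s T i k a b * qMinor s T i j a b) := by
  have hik := hij.trans hjk
  simp only [qMinor, mul_add, add_mul, mul_sub, sub_mul, mul_assoc, smul_mul_assoc, mul_smul_comm,
    smul_sub, smul_add, smul_smul, h.row_swap hs _ hab, h.row_swap_assoc hs _ hab,
    h.main_swap hij, h.main_swap_assoc hij, ← h.anti hij, h.anti_assoc hij, h.col_swap hs _
    hij, h.col_swap_assoc hs _ hij, h.main_swap hik, h.main_swap_assoc hik, ← h.anti hik,
    h.anti_assoc hik, h.col_swap hs _ hik, h.col_swap_assoc hs _ hik, h.main_swap hjk,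
    h.main_swap_assoc hjk, ← h.anti hjk, h.anti_assoc hjk, h.col_swap hs _ hjk,
    h.col_swap_assoc hs _ hjk, hab]
  match_scalars <;> field_simp <;> ring

lemma pair_common_first_sep (h : IsQMat s T) (hs : s ≠ 0) (hij : i < j) (hjk : j < k)
    (hab : a < b) (hbc : b < c) (hcd : c < d) :
    qMinor s T i j a b * qMinor s T i k c d + qMinor s T i j c d * qMinor s T i k a b =
      (s • (qMinor s T i k a b * qMinor s T i j c d) +
        s • (qMinor s T i k c d * qMinor s T i j a b)) := by
  have hik := hij.trans hjk
  have hac := hab.trans hbc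
  have hbd := hbc.trans hcd
  have had := hac.trans hcd
  simp only [qMinor, mul_add, add_mul, mul_sub, sub_mul, mul_assoc, smul_mul_assoc, mul_smul_comm,
    smul_sub, smul_add, smul_smul, h.row_swap hs _ hab, h.row_swap hs _ hac, h.row_swap hs _
    had, h.row_swap hs _ hbc, h.row_swap hs _ hbd, h.row_swap hs _ hcd, h.row_swap_assoc hs
    _ hab, h.row_swap_assoc hs _ hac, h.row_swap_assoc hs _ had, h.row_swap_assoc hs _ hbc,
    h.row_swap_assoc hs _ hbd, h.row_swap_assoc hs _ hcd, h.main_swap hij, h.main_swap_assoc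
    hij, ← h.anti hij, h.anti_assoc hij, h.col_swap hs _ hij, h.col_swap_assoc hs _ hij,
    h.main_swap hik, h.main_swap_assoc hik, ← h.anti hik, h.anti_assoc hik, h.col_swap hs _
    hik, h.col_swap_assoc hs _ hik, h.main_swap hjk, h.main_swap_assoc hjk, ← h.anti hjk,
    h.anti_assoc hjk, h.col_swap hs _ hjk, h.col_swap_assoc hs _ hjk, hab, hac, had, hbc,
    hbd, hcd]
  match_scalars <;> field_simp <;> ring

lemma pair_common_middle_same (h : IsQMat s T) (hs : s ≠ 0) (hij : i < j) (hjk : j < k) (hab : a < b) :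
    qMinor s T i j a b * qMinor s T j k a b =
      s • (qMinor s T j k a b * qMinor s T i j a b) := by
  have hik := hij.trans hjk
  simp only [qMinor, mul_add, add_mul, mul_sub, sub_mul, mul_assoc, smul_mul_assoc, mul_smul_comm,
    smul_sub, smul_add, smul_smul, h.row_swap hs _ hab, h.row_swap_assoc hs _ hab,
    h.main_swap hij, h.main_swap_assoc hij, ← h.anti hij, h.anti_assoc hij, h.col_swap hs _
    hij, h.col_swap_assoc hs _ hij, h.main_swap hik, h.main_swap_assoc hik, ← h.anti hik,
    h.anti_assoc hik, h.col_swap hs _ hik, h.col_swap_assoc hs _ hik, h.main_swap hjk,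
    h.main_swap_assoc hjk, ← h.anti hjk, h.anti_assoc hjk, h.col_swap hs _ hjk,
    h.col_swap_assoc hs _ hjk, hab]
  match_scalars <;> field_simp <;> ring

lemma pair_common_middle_sep (h : IsQMat s T) (hs : s ≠ 0) (hij : i < j) (hjk : j < k)
    (hab : a < b) (hbc : b < c) (hcd : c < d) :
    qMinor s T i j a b * qMinor s T j k c d + qMinor s T i j c d * qMinor s T j k a b =
      (s • (qMinor s T j k a b * qMinor s T i j c d) +
        s • (qMinor s T j k c d * qMinor s T i j a b)) := by
  have hik := hij.trans hjk
  have hac := hab.trans hbc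
  have hbd := hbc.trans hcd
  have had := hac.trans hcd
  simp only [qMinor, mul_add, add_mul, mul_sub, sub_mul, mul_assoc, smul_mul_assoc, mul_smul_comm,
    smul_sub, smul_add, smul_smul, h.row_swap hs _ hab, h.row_swap hs _ hac, h.row_swap hs _
    had, h.row_swap hs _ hbc, h.row_swap hs _ hbd, h.row_swap hs _ hcd, h.row_swap_assoc hs
    _ hab, h.row_swap_assoc hs _ hac, h.row_swap_assoc hs _ had, h.row_swap_assoc hs _ hbc,
    h.row_swap_assoc hs _ hbd, h.row_swap_assoc hs _ hcd, h.main_swap hij, h.main_swap_assoc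
    hij, ← h.anti hij, h.anti_assoc hij, h.col_swap hs _ hij, h.col_swap_assoc hs _ hij,
    h.main_swap hik, h.main_swap_assoc hik, ← h.anti hik, h.anti_assoc hik, h.col_swap hs _
    hik, h.col_swap_assoc hs _ hik, h.main_swap hjk, h.main_swap_assoc hjk, ← h.anti hjk,
    h.anti_assoc hjk, h.col_swap hs _ hjk, h.col_swap_assoc hs _ hjk, hab, hac, had, hbc,
    hbd, hcd]
  match_scalars <;> field_simp <;> ring

lemma pair_common_last_same (h : IsQMat s T) (hs : s ≠ 0) (hij : i < j) (hjk : j < k) (hab : a < b) :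
    qMinor s T i k a b * qMinor s T j k a b =
      s • (qMinor s T j k a b * qMinor s T i k a b) := by
  have hik := hij.trans hjk
  simp only [qMinor, mul_add, add_mul, mul_sub, sub_mul, mul_assoc, smul_mul_assoc, mul_smul_comm,
    smul_sub, smul_add, smul_smul, h.row_swap hs _ hab, h.row_swap_assoc hs _ hab,
    h.main_swap hij, h.main_swap_assoc hij, ← h.anti hij, h.anti_assoc hij, h.col_swap hs _
    hij, h.col_swap_assoc hs _ hij, h.main_swap hik, h.main_swap_assoc hik, ← h.anti hik,
    h.anti_assoc hik, h.col_swap hs _ hik, h.col_swap_assoc hs _ hik, h.main_swap hjk,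
    h.main_swap_assoc hjk, ← h.anti hjk, h.anti_assoc hjk, h.col_swap hs _ hjk,
    h.col_swap_assoc hs _ hjk, hab]
  match_scalars <;> field_simp <;> ring

lemma pair_common_last_sep (h : IsQMat s T) (hs : s ≠ 0) (hij : i < j) (hjk : j < k)
    (hab : a < b) (hbc : b < c) (hcd : c < d) :
    qMinor s T i k a b * qMinor s T j k c d + qMinor s T i k c d * qMinor s T j k a b =
      (s • (qMinor s T j k a b * qMinor s T i k c d) +
        s • (qMinor s T j k c d * qMinor s T i k a b)) := by
  have hik := hij.trans hjk
  have hac := hab.trans hbc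
  have hbd := hbc.trans hcd
  have had := hac.trans hcd
  simp only [qMinor, mul_add, add_mul, mul_sub, sub_mul, mul_assoc, smul_mul_assoc, mul_smul_comm,
    smul_sub, smul_add, smul_smul, h.row_swap hs _ hab, h.row_swap hs _ hac, h.row_swap hs _
    had, h.row_swap hs _ hbc, h.row_swap hs _ hbd, h.row_swap hs _ hcd, h.row_swap_assoc hs
    _ hab, h.row_swap_assoc hs _ hac, h.row_swap_assoc hs _ had, h.row_swap_assoc hs _ hbc,
    h.row_swap_assoc hs _ hbd, h.row_swap_assoc hs _ hcd, h.main_swap hij, h.main_swap_assoc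
    hij, ← h.anti hij, h.anti_assoc hij, h.col_swap hs _ hij, h.col_swap_assoc hs _ hij,
    h.main_swap hik, h.main_swap_assoc hik, ← h.anti hik, h.anti_assoc hik, h.col_swap hs _
    hik, h.col_swap_assoc hs _ hik, h.main_swap hjk, h.main_swap_assoc hjk, ← h.anti hjk,
    h.anti_assoc hjk, h.col_swap hs _ hjk, h.col_swap_assoc hs _ hjk, hab, hac, had, hbc,
    hbd, hcd]
  match_scalars <;> field_simp <;> ring

lemma pair_nested_same (h : IsQMat s T) (hs : s ≠ 0) (hij : i < j) (hjk : j < k) (hkl : k < l) (hab : a < b) :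
    qMinor s T i l a b * qMinor s T j k a b =
      qMinor s T j k a b * qMinor s T i l a b := by
  have hik := hij.trans hjk
  have hjl := hjk.trans hkl
  have hil := hik.trans hkl
  simp only [qMinor, mul_add, add_mul, mul_sub, sub_mul, mul_assoc, smul_mul_assoc, mul_smul_comm,
    smul_sub, smul_add, smul_smul, h.row_swap hs _ hab, h.row_swap_assoc hs _ hab,
    h.main_swap hij, h.main_swap_assoc hij, ← h.anti hij, h.anti_assoc hij, h.col_swap hs _
    hij, h.col_swap_assoc hs _ hij, h.main_swap hik, h.main_swap_assoc hik, ← h.anti hik,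
    h.anti_assoc hik, h.col_swap hs _ hik, h.col_swap_assoc hs _ hik, h.main_swap hil,
    h.main_swap_assoc hil, ← h.anti hil, h.anti_assoc hil, h.col_swap hs _ hil,
    h.col_swap_assoc hs _ hil, h.main_swap hjk, h.main_swap_assoc hjk, ← h.anti hjk,
    h.anti_assoc hjk, h.col_swap hs _ hjk, h.col_swap_assoc hs _ hjk, h.main_swap hjl,
    h.main_swap_assoc hjl, ← h.anti hjl, h.anti_assoc hjl, h.col_swap hs _ hjl,
    h.col_swap_assoc hs _ hjl, h.main_swap hkl, h.main_swap_assoc hkl, ← h.anti hkl,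
    h.anti_assoc hkl, h.col_swap hs _ hkl, h.col_swap_assoc hs _ hkl, hab]
  match_scalars <;> field_simp <;> ring

lemma pair_nested_sep (h : IsQMat s T) (hs : s ≠ 0) (hij : i < j) (hjk : j < k) (hkl : k < l)
    (hab : a < b) (hbc : b < c) (hcd : c < d) :
    qMinor s T i l a b * qMinor s T j k c d + qMinor s T i l c d * qMinor s T j k a b =
      (qMinor s T j k a b * qMinor s T i l c d +
        qMinor s T j k c d * qMinor s T i l a b) := by
  have hik := hij.trans hjk
  have hjl := hjk.trans hkl
  have hil := hik.trans hkl
  have hac := hab.trans hbc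
  have hbd := hbc.trans hcd
  have had := hac.trans hcd
  simp only [qMinor, mul_add, add_mul, mul_sub, sub_mul, mul_assoc, smul_mul_assoc, mul_smul_comm,
    smul_sub, smul_add, smul_smul, h.row_swap hs _ hab, h.row_swap hs _ hac, h.row_swap hs _
    had, h.row_swap hs _ hbc, h.row_swap hs _ hbd, h.row_swap hs _ hcd, h.row_swap_assoc hs
    _ hab, h.row_swap_assoc hs _ hac, h.row_swap_assoc hs _ had, h.row_swap_assoc hs _ hbc,
    h.row_swap_assoc hs _ hbd, h.row_swap_assoc hs _ hcd, h.main_swap hij, h.main_swap_assoc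
    hij, ← h.anti hij, h.anti_assoc hij, h.col_swap hs _ hij, h.col_swap_assoc hs _ hij,
    h.main_swap hik, h.main_swap_assoc hik, ← h.anti hik, h.anti_assoc hik, h.col_swap hs _
    hik, h.col_swap_assoc hs _ hik, h.main_swap hil, h.main_swap_assoc hil, ← h.anti hil,
    h.anti_assoc hil, h.col_swap hs _ hil, h.col_swap_assoc hs _ hil, h.main_swap hjk,
    h.main_swap_assoc hjk, ← h.anti hjk, h.anti_assoc hjk, h.col_swap hs _ hjk,
    h.col_swap_assoc hs _ hjk, h.main_swap hjl, h.main_swap_assoc hjl, ← h.anti hjl,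
    h.anti_assoc hjl, h.col_swap hs _ hjl, h.col_swap_assoc hs _ hjl, h.main_swap hkl,
    h.main_swap_assoc hkl, ← h.anti hkl, h.anti_assoc hkl, h.col_swap hs _ hkl,
    h.col_swap_assoc hs _ hkl, hab, hac, had, hbc, hbd, hcd]
  match_scalars <;> field_simp <;> ring

lemma pair_crossing_same (h : IsQMat s T) (hs : s ≠ 0) (hij : i < j) (hjk : j < k) (hkl : k < l) (hab : a < b) :
    qMinor s T i k a b * qMinor s T j l a b =
      qMinor s T j l a b * qMinor s T i k a b +
      (s - s⁻¹) • (qMinor s T i l a b * qMinor s T j k a b) := by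
  have hik := hij.trans hjk
  have hjl := hjk.trans hkl
  have hil := hik.trans hkl
  simp only [qMinor, mul_add, add_mul, mul_sub, sub_mul, mul_assoc, smul_mul_assoc, mul_smul_comm,
    smul_sub, smul_add, smul_smul, h.row_swap hs _ hab, h.row_swap_assoc hs _ hab,
    h.main_swap hij, h.main_swap_assoc hij, ← h.anti hij, h.anti_assoc hij, h.col_swap hs _
    hij, h.col_swap_assoc hs _ hij, h.main_swap hik, h.main_swap_assoc hik, ← h.anti hik,
    h.anti_assoc hik, h.col_swap hs _ hik, h.col_swap_assoc hs _ hik, h.main_swap hil,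
    h.main_swap_assoc hil, ← h.anti hil, h.anti_assoc hil, h.col_swap hs _ hil,
    h.col_swap_assoc hs _ hil, h.main_swap hjk, h.main_swap_assoc hjk, ← h.anti hjk,
    h.anti_assoc hjk, h.col_swap hs _ hjk, h.col_swap_assoc hs _ hjk, h.main_swap hjl,
    h.main_swap_assoc hjl, ← h.anti hjl, h.anti_assoc hjl, h.col_swap hs _ hjl,
    h.col_swap_assoc hs _ hjl, h.main_swap hkl, h.main_swap_assoc hkl, ← h.anti hkl,
    h.anti_assoc hkl, h.col_swap hs _ hkl, h.col_swap_assoc hs _ hkl, hab]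
  match_scalars <;> field_simp <;> ring

lemma pair_crossing_sep (h : IsQMat s T) (hs : s ≠ 0) (hij : i < j) (hjk : j < k) (hkl : k < l)
    (hab : a < b) (hbc : b < c) (hcd : c < d) :
    qMinor s T i k a b * qMinor s T j l c d + qMinor s T i k c d * qMinor s T j l a b =
      (qMinor s T j l a b * qMinor s T i k c d +
        qMinor s T j l c d * qMinor s T i k a b) +
      ((s - s⁻¹) • (qMinor s T i l a b * qMinor s T j k c d) +
        (s - s⁻¹) • (qMinor s T i l c d * qMinor s T j k a b)) := by
  have hik := hij.trans hjk
  have hjl := hjk.trans hkl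
  have hil := hik.trans hkl
  have hac := hab.trans hbc
  have hbd := hbc.trans hcd
  have had := hac.trans hcd
  simp only [qMinor, mul_add, add_mul, mul_sub, sub_mul, mul_assoc, smul_mul_assoc, mul_smul_comm,
    smul_sub, smul_add, smul_smul, h.row_swap hs _ hab, h.row_swap hs _ hac, h.row_swap hs _
    had, h.row_swap hs _ hbc, h.row_swap hs _ hbd, h.row_swap hs _ hcd, h.row_swap_assoc hs
    _ hab, h.row_swap_assoc hs _ hac, h.row_swap_assoc hs _ had, h.row_swap_assoc hs _ hbc,
    h.row_swap_assoc hs _ hbd, h.row_swap_assoc hs _ hcd, h.main_swap hij, h.main_swap_assoc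
    hij, ← h.anti hij, h.anti_assoc hij, h.col_swap hs _ hij, h.col_swap_assoc hs _ hij,
    h.main_swap hik, h.main_swap_assoc hik, ← h.anti hik, h.anti_assoc hik, h.col_swap hs _
    hik, h.col_swap_assoc hs _ hik, h.main_swap hil, h.main_swap_assoc hil, ← h.anti hil,
    h.anti_assoc hil, h.col_swap hs _ hil, h.col_swap_assoc hs _ hil, h.main_swap hjk,
    h.main_swap_assoc hjk, ← h.anti hjk, h.anti_assoc hjk, h.col_swap hs _ hjk,
    h.col_swap_assoc hs _ hjk, h.main_swap hjl, h.main_swap_assoc hjl, ← h.anti hjl,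
    h.anti_assoc hjl, h.col_swap hs _ hjl, h.col_swap_assoc hs _ hjl, h.main_swap hkl,
    h.main_swap_assoc hkl, ← h.anti hkl, h.anti_assoc hkl, h.col_swap hs _ hkl,
    h.col_swap_assoc hs _ hkl, hab, hac, had, hbc, hbd, hcd]
  match_scalars <;> field_simp <;> ring

lemma pair_disjoint_same (h : IsQMat s T) (hs : s ≠ 0) (hij : i < j) (hjk : j < k) (hkl : k < l) (hab : a < b) :
    qMinor s T i j a b * qMinor s T k l a b =
      qMinor s T k l a b * qMinor s T i j a b +
      (s - s⁻¹) • (qMinor s T i k a b * qMinor s T j l a b) +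
      -(s ^ 2 - 1) • (qMinor s T i l a b * qMinor s T j k a b) := by
  have hik := hij.trans hjk
  have hjl := hjk.trans hkl
  have hil := hik.trans hkl
  simp only [qMinor, mul_add, add_mul, mul_sub, sub_mul, mul_assoc, smul_mul_assoc, mul_smul_comm,
    smul_sub, smul_add, smul_smul, h.row_swap hs _ hab, h.row_swap_assoc hs _ hab,
    h.main_swap hij, h.main_swap_assoc hij, ← h.anti hij, h.anti_assoc hij, h.col_swap hs _
    hij, h.col_swap_assoc hs _ hij, h.main_swap hik, h.main_swap_assoc hik, ← h.anti hik,
    h.anti_assoc hik, h.col_swap hs _ hik, h.col_swap_assoc hs _ hik, h.main_swap hil,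
    h.main_swap_assoc hil, ← h.anti hil, h.anti_assoc hil, h.col_swap hs _ hil,
    h.col_swap_assoc hs _ hil, h.main_swap hjk, h.main_swap_assoc hjk, ← h.anti hjk,
    h.anti_assoc hjk, h.col_swap hs _ hjk, h.col_swap_assoc hs _ hjk, h.main_swap hjl,
    h.main_swap_assoc hjl, ← h.anti hjl, h.anti_assoc hjl, h.col_swap hs _ hjl,
    h.col_swap_assoc hs _ hjl, h.main_swap hkl, h.main_swap_assoc hkl, ← h.anti hkl,
    h.anti_assoc hkl, h.col_swap hs _ hkl, h.col_swap_assoc hs _ hkl, hab]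
  match_scalars <;> field_simp <;> ring

lemma pair_disjoint_sep (h : IsQMat s T) (hs : s ≠ 0) (hij : i < j) (hjk : j < k) (hkl : k < l)
    (hab : a < b) (hbc : b < c) (hcd : c < d) :
    qMinor s T i j a b * qMinor s T k l c d + qMinor s T i j c d * qMinor s T k l a b =
      (qMinor s T k l a b * qMinor s T i j c d +
        qMinor s T k l c d * qMinor s T i j a b) +
      ((s - s⁻¹) • (qMinor s T i k a b * qMinor s T j l c d) +
        (s - s⁻¹) • (qMinor s T i k c d * qMinor s T j l a b)) +
      (-(s ^ 2 - 1) • (qMinor s T i l a b * qMinor s T j k c d) +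
        -(s ^ 2 - 1) • (qMinor s T i l c d * qMinor s T j k a b)) := by
  have hik := hij.trans hjk
  have hjl := hjk.trans hkl
  have hil := hik.trans hkl
  have hac := hab.trans hbc
  have hbd := hbc.trans hcd
  have had := hac.trans hcd
  simp only [qMinor, mul_add, add_mul, mul_sub, sub_mul, mul_assoc, smul_mul_assoc, mul_smul_comm,
    smul_sub, smul_add, smul_smul, h.row_swap hs _ hab, h.row_swap hs _ hac, h.row_swap hs _
    had, h.row_swap hs _ hbc, h.row_swap hs _ hbd, h.row_swap hs _ hcd, h.row_swap_assoc hs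
    _ hab, h.row_swap_assoc hs _ hac, h.row_swap_assoc hs _ had, h.row_swap_assoc hs _ hbc,
    h.row_swap_assoc hs _ hbd, h.row_swap_assoc hs _ hcd, h.main_swap hij, h.main_swap_assoc
    hij, ← h.anti hij, h.anti_assoc hij, h.col_swap hs _ hij, h.col_swap_assoc hs _ hij,
    h.main_swap hik, h.main_swap_assoc hik, ← h.anti hik, h.anti_assoc hik, h.col_swap hs _
    hik, h.col_swap_assoc hs _ hik, h.main_swap hil, h.main_swap_assoc hil, ← h.anti hil,
    h.anti_assoc hil, h.col_swap hs _ hil, h.col_swap_assoc hs _ hil, h.main_swap hjk,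
    h.main_swap_assoc hjk, ← h.anti hjk, h.anti_assoc hjk, h.col_swap hs _ hjk,
    h.col_swap_assoc hs _ hjk, h.main_swap hjl, h.main_swap_assoc hjl, ← h.anti hjl,
    h.anti_assoc hjl, h.col_swap hs _ hjl, h.col_swap_assoc hs _ hjl, h.main_swap hkl,
    h.main_swap_assoc hkl, ← h.anti hkl, h.anti_assoc hkl, h.col_swap hs _ hkl,
    h.col_swap_assoc hs _ hkl, hab, hac, had, hbc, hbd, hcd]
  match_scalars <;> field_simp <;> ring

end IsQMat
end Straightening

section PairSums

variable {F ι κ B : Type*} [Field F] [LinearOrder ι] [LinearOrder κ] [Ring B] [Algebra F B]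

/-- The quadratic relations satisfied by the quantum skew-symmetric generators `x i j`, `i < j`. -/
structure IsQSkew (s : F) (x : ι → ι → B) : Prop where
  common_first : ∀ {i j k}, i < j → j < k →
    x i j * x i k = s • (x i k * x i j)
  common_middle : ∀ {i j k}, i < j → j < k →
    x i j * x j k = s • (x j k * x i j)
  common_last : ∀ {i j k}, i < j → j < k →
    x i k * x j k = s • (x j k * x i k)
  nested : ∀ {i j k l}, i < j → j < k → k < l →
    x i l * x j k = x j k * x i l
  crossing : ∀ {i j k l}, i < j → j < k → k < l →
    x i k * x j l = x j l * x i k + (s - s⁻¹) • (x i l * x j k)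
  disjoint : ∀ {i j k l}, i < j → j < k → k < l →
    x i j * x k l = x k l * x i j + (s - s⁻¹) • (x i k * x j l) + -(s ^ 2 - 1) • (x i l * x j k)

lemma sum_sum_eq_of_symm {n : ℕ} (f g : Fin n → Fin n → B) (hd : ∀ k, f k k = g k k)
    (ho : ∀ k m, k < m → f k m + f m k = g k m + g m k) :
    ∑ k, ∑ m, f k m = ∑ k, ∑ m, g k m := by
  rw [← sub_eq_zero]
  simp only [← Finset.sum_sub_distrib]
  rw [← Finset.sum_product']
  refine Finset.sum_involution (fun p _ => p.swap) ?_ ?_ (fun _ _ => by simp) (fun _ _ => by simp)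
  · rintro ⟨k, m⟩ -
    rcases lt_trichotomy k m with hkm | rfl | hkm
    · rw [← sub_eq_zero.2 (ho k m hkm)]
      simp only [Prod.fst_swap, Prod.snd_swap]
      abel
    · simp [hd]
    · rw [← sub_eq_zero.2 (ho m k hkm)]
      simp only [Prod.fst_swap, Prod.snd_swap]
      abel
  · rintro ⟨k, m⟩ - hne heq
    obtain rfl : m = k := congrArg Prod.fst heq
    exact hne (by simp [hd])

/-- Sums of `2 × 2` minors over separated pairs of columns. -/
def pairSum {n : ℕ} (s : F) (T : ι → κ → B) (α β : Fin n → κ) (i j : ι) : B :=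
  ∑ k, qMinor s T i j (α k) (β k)

lemma IsQMat.isQSkew {n : ℕ} {s : F} {T : ι → κ → B} (h : IsQMat s T) (hs : s ≠ 0)
    {α β : Fin n → κ} (hαβ : ∀ k, α k < β k) (hβα : ∀ k m, k < m → β k < α m) :
    IsQSkew s (pairSum s T α β) where
  common_first {i j k} hij hjk := by
    have key := sum_sum_eq_of_symm (fun u v => qMinor s T i j (α u) (β u) * qMinor s T i k (α v) (β v))
      (fun u v => s • (qMinor s T i k (α u) (β u) * qMinor s T i j (α v) (β v)))
      (fun u => h.pair_common_first_same hs hij hjk (hαβ u))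
      (fun u v huv => (h.pair_common_first_sep hs hij hjk (hαβ u) (hβα u v huv) (hαβ v)).trans
        (by abel))
    simpa only [pairSum, Finset.sum_mul_sum, Finset.sum_add_distrib, ← Finset.smul_sum] using key
  common_middle {i j k} hij hjk := by
    have key := sum_sum_eq_of_symm (fun u v => qMinor s T i j (α u) (β u) * qMinor s T j k (α v) (β v))
      (fun u v => s • (qMinor s T j k (α u) (β u) * qMinor s T i j (α v) (β v)))
      (fun u => h.pair_common_middle_same hs hij hjk (hαβ u))
      (fun u v huv => (h.pair_common_middle_sep hs hij hjk (hαβ u) (hβα u v huv) (hαβ v)).trans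
        (by abel))
    simpa only [pairSum, Finset.sum_mul_sum, Finset.sum_add_distrib, ← Finset.smul_sum] using key
  common_last {i j k} hij hjk := by
    have key := sum_sum_eq_of_symm (fun u v => qMinor s T i k (α u) (β u) * qMinor s T j k (α v) (β v))
      (fun u v => s • (qMinor s T j k (α u) (β u) * qMinor s T i k (α v) (β v)))
      (fun u => h.pair_common_last_same hs hij hjk (hαβ u))
      (fun u v huv => (h.pair_common_last_sep hs hij hjk (hαβ u) (hβα u v huv) (hαβ v)).trans
        (by abel))
    simpa only [pairSum, Finset.sum_mul_sum, Finset.sum_add_distrib, ← Finset.smul_sum] using key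
  nested {i j k l} hij hjk hkl := by
    have key := sum_sum_eq_of_symm (fun u v => qMinor s T i l (α u) (β u) * qMinor s T j k (α v) (β v))
      (fun u v => qMinor s T j k (α u) (β u) * qMinor s T i l (α v) (β v))
      (fun u => h.pair_nested_same hs hij hjk hkl (hαβ u))
      (fun u v huv => (h.pair_nested_sep hs hij hjk hkl (hαβ u) (hβα u v huv) (hαβ v)).trans
        (by abel))
    simpa only [pairSum, Finset.sum_mul_sum, Finset.sum_add_distrib, ← Finset.smul_sum] using key
  crossing {i j k l} hij hjk hkl := by
    have key := sum_sum_eq_of_symm (fun u v => qMinor s T i k (α u) (β u) * qMinor s T j l (α v) (β v))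
      (fun u v => qMinor s T j l (α u) (β u) * qMinor s T i k (α v) (β v) +
        (s - s⁻¹) • (qMinor s T i l (α u) (β u) * qMinor s T j k (α v) (β v)))
      (fun u => h.pair_crossing_same hs hij hjk hkl (hαβ u))
      (fun u v huv => (h.pair_crossing_sep hs hij hjk hkl (hαβ u) (hβα u v huv) (hαβ v)).trans
        (by abel))
    simpa only [pairSum, Finset.sum_mul_sum, Finset.sum_add_distrib, ← Finset.smul_sum] using key
  disjoint {i j k l} hij hjk hkl := by
    have key := sum_sum_eq_of_symm (fun u v => qMinor s T i j (α u) (β u) * qMinor s T k l (α v) (β v))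
      (fun u v => qMinor s T k l (α u) (β u) * qMinor s T i j (α v) (β v) +
        (s - s⁻¹) • (qMinor s T i k (α u) (β u) * qMinor s T j l (α v) (β v)) +
        -(s ^ 2 - 1) • (qMinor s T i l (α u) (β u) * qMinor s T j k (α v) (β v)))
      (fun u => h.pair_disjoint_same hs hij hjk hkl (hαβ u))
      (fun u v huv => (h.pair_disjoint_sep hs hij hjk hkl (hαβ u) (hβα u v huv) (hαβ v)).trans
        (by abel))
    simpa only [pairSum, Finset.sum_mul_sum, Finset.sum_add_distrib, ← Finset.smul_sum] using key

end PairSums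

section SortedWords

variable {F B ι α : Type*} [Field F] [Ring B] [Algebra F B] [LinearOrder α]

/-- The span of the products of weakly increasing words of length `n`. -/
def sortedSpan (F : Type*) [Field F] [Algebra F B] (y : ι → B) (key : ι → α) (n : ℕ) :
    Submodule F B :=
  Submodule.span F {z | ∃ w : List ι, w.length = n ∧ w.Pairwise (key · ≤ key ·) ∧
    z = (w.map y).prod}

lemma mul_mem_sortedSpan [WellFoundedLT α] {y : ι → B} {key : ι → α}
    (hy : ∀ a b, key b < key a →
      y a * y b ∈ Submodule.span F {z | ∃ r s, key r < key a ∧ z = y r * y s}) (n : ℕ) :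
    ∀ a, ∀ z ∈ sortedSpan F y key n, y a * z ∈ sortedSpan F y key (n + 1) := by
  induction n with
  | zero =>
    intro a z hz
    induction hz using Submodule.span_induction with
    | mem z hz =>
      obtain ⟨w, hw, -, rfl⟩ := hz
      obtain rfl := List.length_eq_zero_iff.1 hw
      exact Submodule.subset_span ⟨[a], rfl, by simp, by simp⟩
    | zero => simp
    | add u v _ _ hu hv => rw [mul_add]; exact add_mem hu hv
    | smul c u _ hu => rw [mul_smul_comm]; exact Submodule.smul_mem _ _ hu
  | succ n ih =>
    intro a
    induction hk : key a using WellFoundedLT.induction generalizing a with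
    | _ k iha =>
    subst hk
    intro z hz
    induction hz using Submodule.span_induction with
    | zero => simp
    | add u v _ _ hu hv => rw [mul_add]; exact add_mem hu hv
    | smul c u _ hu => rw [mul_smul_comm]; exact Submodule.smul_mem _ _ hu
    | mem z hz =>
      obtain ⟨w, hw, hs, rfl⟩ := hz
      obtain ⟨b, t, rfl⟩ := List.exists_cons_of_length_eq_add_one hw
      rcases le_or_gt (key a) (key b) with hab | hab
      · refine Submodule.subset_span ⟨a :: b :: t, by simpa using hw, ?_, by simp⟩
        refine List.pairwise_cons.2 ⟨fun c hc => ?_, hs⟩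
        rcases List.mem_cons.1 hc with rfl | hc
        · exact hab
        · exact hab.trans ((List.pairwise_cons.1 hs).1 c hc)
      · have ht : (t.map y).prod ∈ sortedSpan F y key n :=
          Submodule.subset_span ⟨t, by simpa using hw, (List.pairwise_cons.1 hs).2, rfl⟩
        rw [List.map_cons, List.prod_cons, ← mul_assoc]
        have hyab := hy a b hab
        generalize y a * y b = u at hyab
        induction hyab using Submodule.span_induction with
        | mem z hz =>
          obtain ⟨r, s, hr, rfl⟩ := hz
          rw [mul_assoc]
          exact iha _ hr r rfl _ (ih s _ ht)
        | zero => simp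
        | add u v _ _ hu hv => rw [add_mul]; exact add_mem hu hv
        | smul c u _ hu => rw [smul_mul_assoc]; exact Submodule.smul_mem _ _ hu

lemma word_mem_sortedSpan [WellFoundedLT α] {y : ι → B} {key : ι → α}
    (hy : ∀ a b, key b < key a →
      y a * y b ∈ Submodule.span F {z | ∃ r s, key r < key a ∧ z = y r * y s}) (w : List ι) :
    (w.map y).prod ∈ sortedSpan F y key w.length := by
  induction w with
  | nil => exact Submodule.subset_span ⟨[], by simp⟩
  | cons a w ih => simpa using mul_mem_sortedSpan hy _ a _ ih

lemma prod_flatMap_replicate (y : ι → B) (c : ι → ℕ) (L : List ι) :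
    ((L.flatMap fun p => List.replicate (c p) p).map y).prod =
      (L.map fun p => y p ^ c p).prod := by
  induction L with
  | nil => simp
  | cons p L ih => simp [ih]

lemma prod_sorted_eq_prod_pow [DecidableEq ι] {y : ι → B} {key : ι → α}
    (hkey : Function.Injective key) {L : List ι} (hL : L.Pairwise (key · < key ·))
    (hmem : ∀ p, p ∈ L) {w : List ι} (hw : w.Pairwise (key · ≤ key ·)) :
    (w.map y).prod = (L.map fun p => y p ^ w.count p).prod := by
  have hnd : L.Nodup := hL.imp fun h => by rintro rfl; exact lt_irrefl _ h
  have hperm : w.Perm (L.flatMap fun p => List.replicate (w.count p) p) := by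
    rw [List.perm_iff_count]
    intro p
    rw [List.count_flatMap]
    simp only [Function.comp_def, List.count_replicate, beq_iff_eq]
    rw [← List.sum_toFinset _ hnd]
    simp [hmem p]
  have hsort : (L.flatMap fun p => List.replicate (w.count p) p).Pairwise (key · ≤ key ·) := by
    rw [List.flatMap_def, List.pairwise_flatten]
    refine ⟨?_, ?_⟩
    · intro l hl
      obtain ⟨p, -, rfl⟩ := List.mem_map.1 hl
      exact List.pairwise_replicate.2 (Or.inr le_rfl)
    · rw [List.pairwise_map]
      refine hL.imp fun {p r} h u hu v hv => ?_
      rw [List.eq_of_mem_replicate hu, List.eq_of_mem_replicate hv]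
      exact h.le
  have heq := hperm.eq_of_pairwise (fun a b _ _ h1 h2 => hkey (le_antisymm h1 h2)) hw hsort
  exact (congrArg (fun v => (v.map y).prod) heq).trans (prod_flatMap_replicate y _ L)

/-- If descents can be straightened, the ordered monomials span the subalgebra generated. -/
lemma span_range_eq_adjoin [WellFoundedLT α] {y : ι → B} {key : ι → α}
    (hkey : Function.Injective key)
    (hy : ∀ a b, key b < key a →
      y a * y b ∈ Submodule.span F {z | ∃ r s, key r < key a ∧ z = y r * y s})
    {L : List ι} (hL : L.Pairwise (key · < key ·)) (hmem : ∀ p, p ∈ L) :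
    Submodule.span F (Set.range fun m : ι → ℕ => (L.map fun p => y p ^ m p).prod) =
      Subalgebra.toSubmodule (Algebra.adjoin F (Set.range y)) := by
  classical
  apply le_antisymm
  · rw [Submodule.span_le]
    rintro _ ⟨m, rfl⟩
    refine Subalgebra.list_prod_mem _ fun z hz => ?_
    obtain ⟨p, -, rfl⟩ := List.mem_map.1 hz
    exact pow_mem (Algebra.subset_adjoin (Set.mem_range_self p)) _
  · rw [Algebra.adjoin_eq_span, Submodule.span_le]
    intro z hz
    obtain ⟨l, hl, rfl⟩ := Submonoid.exists_list_of_mem_closure hz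
    have hl' : l ∈ Set.range (List.map y) := by rw [Set.range_list_map]; exact hl
    obtain ⟨w, rfl⟩ := hl'
    refine Submodule.span_mono ?_ (word_mem_sortedSpan hy w)
    rintro _ ⟨v, -, hv, rfl⟩
    exact ⟨fun p => v.count p, (prod_sorted_eq_prod_pow hkey hL hmem hv).symm⟩

end SortedWords

section SkewStraightening

variable {F ι B : Type*} [Field F] [LinearOrder ι] [Ring B] [Algebra F B]

lemma IsQSkew.exists_commute {s : F} {x : ι → ι → B} (h : IsQSkew s x) (hs : s ≠ 0)
    {i j k l : ι} (hij : i < j) (hkl : k < l) (hlt : toLex (i, j) < toLex (k, l)) :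
    ∃ c : F, c ≠ 0 ∧ x i j * x k l - c • (x k l * x i j) ∈
      Submodule.span F {z | ∃ r t : {p : ι × ι // p.1 < p.2}, toLex (i, j) < toLex r.1 ∧
        toLex r.1 < toLex (k, l) ∧ z = x r.1.1 r.1.2 * x t.1.1 t.1.2} := by
  have mem : ∀ {a b c d : ι} (_ : a < b) (_ : c < d), toLex (i, j) < toLex (a, b) →
      toLex (a, b) < toLex (k, l) → x a b * x c d ∈
        Submodule.span F {z | ∃ r t : {p : ι × ι // p.1 < p.2}, toLex (i, j) < toLex r.1 ∧
        toLex r.1 < toLex (k, l) ∧ z = x r.1.1 r.1.2 * x t.1.1 t.1.2} :=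
    fun hab hcd h1 h2 => Submodule.subset_span ⟨⟨(_, _), hab⟩, ⟨(_, _), hcd⟩, h1, h2, rfl⟩
  rw [Prod.Lex.toLex_lt_toLex] at hlt
  rcases hlt with hik | ⟨hik, hjl⟩
  · simp only at hik
    rcases lt_trichotomy j k with hjk | rfl | hkj
    · refine ⟨1, one_ne_zero, ?_⟩
      have e : x i j * x k l - (1 : F) • (x k l * x i j) =
          (s - s⁻¹) • (x i k * x j l) + (-(s ^ 2 - 1)) • (x i l * x j k) := by
        rw [h.disjoint hij hjk hkl, one_smul]; abel
      rw [e]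
      refine add_mem (Submodule.smul_mem _ _ (mem hik (hjk.trans hkl) ?_ ?_))
        (Submodule.smul_mem _ _ (mem (hik.trans hkl) hjk ?_ ?_)) <;>
        simp [Prod.Lex.toLex_lt_toLex, hjk, hik, hjk.trans hkl]
    · exact ⟨s, hs, by simp [h.common_middle hij hkl]⟩
    · rcases lt_trichotomy j l with hjl | rfl | hlj
      · refine ⟨1, one_ne_zero, ?_⟩
        rw [h.crossing hik hkj hjl, one_smul, add_sub_cancel_left]
        refine Submodule.smul_mem _ _ (mem (hik.trans hkl) hkj ?_ ?_) <;>
          simp [Prod.Lex.toLex_lt_toLex, hik, hjl]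
      · exact ⟨s, hs, by simp [h.common_last hik hkj]⟩
      · exact ⟨1, one_ne_zero, by simp [h.nested hik hkl hlj]⟩
  · simp only at hik hjl
    subst hik
    exact ⟨s, hs, by simp [h.common_first hij hjl]⟩

variable [Finite ι]

lemma IsQSkew.span_lex {s : F} {x : ι → ι → B} (h : IsQSkew s x) (hs : s ≠ 0)
    {L : List {p : ι × ι // p.1 < p.2}} (hL : L.Pairwise (toLex ·.1 < toLex ·.1))
    (hmem : ∀ p, p ∈ L) :
    Submodule.span F (Set.range fun m : {p : ι × ι // p.1 < p.2} → ℕ =>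
      (L.map fun p => x p.1.1 p.1.2 ^ m p).prod) =
      Subalgebra.toSubmodule (Algebra.adjoin F
        (Set.range fun p : {p : ι × ι // p.1 < p.2} => x p.1.1 p.1.2)) := by
  have : Finite (ι ×ₗ ι) := inferInstanceAs (Finite (ι × ι))
  have : WellFoundedLT (ι ×ₗ ι) := Finite.to_wellFoundedLT
  refine span_range_eq_adjoin (key := fun p : {p : ι × ι // p.1 < p.2} => toLex p.1)
    (toLex.injective.comp Subtype.val_injective) (fun a b hba => ?_) hL hmem
  obtain ⟨c, hc, hcomm⟩ :=
    h.exists_commute hs (i := b.1.1) (j := b.1.2) (k := a.1.1) (l := a.1.2) b.2 a.2 hba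
  have e : x a.1.1 a.1.2 * x b.1.1 b.1.2 = c⁻¹ • (x b.1.1 b.1.2 * x a.1.1 a.1.2) -
      c⁻¹ • (x b.1.1 b.1.2 * x a.1.1 a.1.2 - c • (x a.1.1 a.1.2 * x b.1.1 b.1.2)) := by
    rw [smul_sub, smul_smul, inv_mul_cancel₀ hc, one_smul, sub_sub_cancel]
  rw [e]
  refine sub_mem (Submodule.smul_mem _ _ (Submodule.subset_span ⟨b, a, hba, rfl⟩))
    (Submodule.smul_mem _ _ (Submodule.span_mono ?_ hcomm))
  rintro _ ⟨r, t, -, hr, rfl⟩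
  exact ⟨r, t, hr, rfl⟩

lemma IsQSkew.span_revLex {s : F} {x : ι → ι → B} (h : IsQSkew s x) (hs : s ≠ 0)
    {L : List {p : ι × ι // p.1 < p.2}} (hL : L.Pairwise (toLex ·.1 > toLex ·.1))
    (hmem : ∀ p, p ∈ L) :
    Submodule.span F (Set.range fun m : {p : ι × ι // p.1 < p.2} → ℕ =>
      (L.map fun p => x p.1.1 p.1.2 ^ m p).prod) =
      Subalgebra.toSubmodule (Algebra.adjoin F
        (Set.range fun p : {p : ι × ι // p.1 < p.2} => x p.1.1 p.1.2)) := by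
  have : Finite (ι ×ₗ ι)ᵒᵈ := inferInstanceAs (Finite (ι × ι))
  have : WellFoundedLT (ι ×ₗ ι)ᵒᵈ := Finite.to_wellFoundedLT
  refine span_range_eq_adjoin
    (key := fun p : {p : ι × ι // p.1 < p.2} => OrderDual.toDual (toLex p.1))
    (OrderDual.toDual.injective.comp (toLex.injective.comp Subtype.val_injective))
    (fun a b hba => ?_) hL hmem
  obtain ⟨c, -, hcomm⟩ :=
    h.exists_commute hs (i := a.1.1) (j := a.1.2) (k := b.1.1) (l := b.1.2) a.2 b.2 hba
  rw [← sub_add_cancel (x a.1.1 a.1.2 * x b.1.1 b.1.2) (c • (x b.1.1 b.1.2 * x a.1.1 a.1.2))]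
  refine add_mem (Submodule.span_mono ?_ hcomm)
    (Submodule.smul_mem _ _ (Submodule.subset_span ⟨b, a, hba, rfl⟩))
  rintro _ ⟨r, t, hr, -, rfl⟩
  exact ⟨r, t, hr, rfl⟩

end SkewStraightening

section SkewGenerators

lemma isQMat_tGen (n : ℕ) : IsQMat q (tGen : Fin n → Fin n → OqMat n) where
  row l i j h := by
    simpa [tGen] using RingQuot.mkAlgHom_rel K (matRel.rowq l i j h)
  col l i j h := by
    simpa [tGen] using RingQuot.mkAlgHom_rel K (matRel.colq l i j h)
  anti {i k j l} h1 h2 := by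
    simpa [tGen] using RingQuot.mkAlgHom_rel K (matRel.anti i k j l h1 h2)
  main {i k j l} h1 h2 := by
    simpa only [tGen, map_mul, map_add, map_smul] using
      RingQuot.mkAlgHom_rel K (matRel.main i k j l h1 h2)

lemma xAII_eq_pairSum (n : ℕ) : xAII n = pairSum q tGen (c1 n) (c2 n) := rfl

lemma isQSkew_xAII (n : ℕ) : IsQSkew q (xAII n) := by
  rw [xAII_eq_pairSum]
  refine (isQMat_tGen (2 * n)).isQSkew q_ne_zero (fun k => ?_) fun k m h => ?_
  · simp [c1, c2, Fin.lt_def]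
  · simp only [c1, c2, Fin.lt_def] at h ⊢
    omega

lemma IsQMat.qMinor_self {F ι κ B : Type*} [Field F] [LinearOrder ι] [LinearOrder κ] [Ring B]
    [Algebra F B] {s : F} {T : ι → κ → B} (h : IsQMat s T) (i : ι) {a b : κ} (hab : a < b) :
    qMinor s T i i a b = 0 := by
  rw [qMinor, h.row i hab, sub_self]

lemma IsQMat.qMinor_swap {F ι κ B : Type*} [Field F] [LinearOrder ι] [LinearOrder κ] [Ring B]
    [Algebra F B] {s : F} {T : ι → κ → B} (h : IsQMat s T) (hs : s ≠ 0) {i j : ι} (hij : i < j)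
    {a b : κ} (hab : a < b) : qMinor s T j i a b = -s • qMinor s T i j a b := by
  rw [qMinor, qMinor, h.main_swap hij hab, ← h.anti hij hab]
  simp only [smul_sub, smul_smul, sub_smul, neg_mul, neg_smul, mul_sub, mul_inv_cancel₀ hs,
    one_smul]
  abel

lemma xAII_self (n : ℕ) (i : Fin (2 * n)) : xAII n i i = 0 := by
  rw [xAII_eq_pairSum]
  refine Finset.sum_eq_zero fun k _ => (isQMat_tGen (2 * n)).qMinor_self i ?_
  simp [c1, c2, Fin.lt_def]

lemma xAII_swap (n : ℕ) {i j : Fin (2 * n)} (hij : i < j) : xAII n j i = -q • xAII n i j := by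
  rw [xAII_eq_pairSum, pairSum, pairSum, Finset.smul_sum]
  refine Finset.sum_congr rfl fun k _ => (isQMat_tGen (2 * n)).qMinor_swap q_ne_zero hij ?_
  simp [c1, c2, Fin.lt_def]

lemma adjoin_xAII (n : ℕ) :
    Algebra.adjoin K {y : OqMat (2 * n) | ∃ i j : Fin (2 * n), y = xAII n i j} =
      Algebra.adjoin K (Set.range
        fun p : {p : Fin (2 * n) × Fin (2 * n) // p.1 < p.2} => xAII n p.1.1 p.1.2) := by
  apply le_antisymm
  · refine Algebra.adjoin_le ?_
    rintro _ ⟨i, j, rfl⟩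
    rcases lt_trichotomy i j with hij | rfl | hij
    · exact Algebra.subset_adjoin ⟨⟨(i, j), hij⟩, rfl⟩
    · rw [xAII_self]; exact zero_mem _
    · rw [xAII_swap n hij]
      refine SMulMemClass.smul_mem _ ?_
      exact Algebra.subset_adjoin (Set.mem_range.2 ⟨⟨(j, i), hij⟩, rfl⟩)
  · refine Algebra.adjoin_mono ?_
    rintro _ ⟨p, rfl⟩
    exact ⟨_, _, rfl⟩

lemma mem_pairListAII {n : ℕ} {p : Fin (2 * n) × Fin (2 * n)} :
    p ∈ pairListAII n ↔ p.1 < p.2 := by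
  obtain ⟨i, j⟩ := p
  simp [pairListAII]

lemma pairwise_pairListAII (n : ℕ) :
    (pairListAII n).Pairwise (toLex · < toLex ·) := by
  rw [pairListAII, List.flatMap_def, List.pairwise_flatten]
  constructor
  · intro l hl
    obtain ⟨i, -, rfl⟩ := List.mem_map.1 hl
    rw [List.pairwise_map]
    refine ((List.pairwise_lt_finRange _).filter _).imp fun h => ?_
    simp [Prod.Lex.toLex_lt_toLex, h]
  · rw [List.pairwise_map]
    refine (List.pairwise_lt_finRange _).imp fun {a b} h u hu v hv => ?_
    simp only [List.mem_map] at hu hv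
    obtain ⟨x, -, rfl⟩ := hu
    obtain ⟨y, -, rfl⟩ := hv
    simp [Prod.Lex.toLex_lt_toLex, h]

/-- The list of pairs `i < j` in lexicographic order, as a list in the subtype. -/
def pairListSubtype (n : ℕ) : List {p : Fin (2 * n) × Fin (2 * n) // p.1 < p.2} :=
  (pairListAII n).attach.map fun p => ⟨p.1, mem_pairListAII.1 p.2⟩

lemma map_val_pairListSubtype (n : ℕ) :
    (pairListSubtype n).map Subtype.val = pairListAII n := by
  rw [pairListSubtype, List.map_map]
  exact List.attach_map_subtype_val _

lemma mem_pairListSubtype {n : ℕ} (p : {p : Fin (2 * n) × Fin (2 * n) // p.1 < p.2}) :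
    p ∈ pairListSubtype n := by
  simp only [pairListSubtype, List.mem_map, List.mem_attach, true_and]
  exact ⟨⟨p.1, mem_pairListAII.2 p.2⟩, rfl⟩

lemma pairwise_pairListSubtype (n : ℕ) :
    (pairListSubtype n).Pairwise (toLex ·.1 < toLex ·.1) := by
  have h := pairwise_pairListAII n
  rwa [← map_val_pairListSubtype, List.pairwise_map] at h

lemma monoAII_eq (n : ℕ) (m : {p : Fin (2 * n) × Fin (2 * n) // p.1 < p.2} → ℕ) :
    monoAII n m = ((pairListSubtype n).map fun p => xAII n p.1.1 p.1.2 ^ m p).prod := by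
  rw [monoAII, ← map_val_pairListSubtype, List.map_map]
  refine congrArg _ (List.map_congr_left fun p _ => ?_)
  simp [p.2]

lemma monoAIIrev_eq (n : ℕ) (m : {p : Fin (2 * n) × Fin (2 * n) // p.1 < p.2} → ℕ) :
    monoAIIrev n m =
      ((pairListSubtype n).reverse.map fun p => xAII n p.1.1 p.1.2 ^ m p).prod := by
  rw [monoAIIrev, ← map_val_pairListSubtype, ← List.map_reverse, List.map_map]
  refine congrArg _ (List.map_congr_left fun p _ => ?_)
  simp [p.2]

lemma span_range_monoAII (n : ℕ) :
    Submodule.span K (Set.range (monoAII n)) = Subalgebra.toSubmodule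
      (Algebra.adjoin K {y : OqMat (2 * n) | ∃ i j : Fin (2 * n), y = xAII n i j}) := by
  rw [adjoin_xAII, ← (isQSkew_xAII n).span_lex q_ne_zero (pairwise_pairListSubtype n)
    mem_pairListSubtype, ← funext (monoAII_eq n)]

lemma span_range_monoAIIrev (n : ℕ) :
    Submodule.span K (Set.range (monoAIIrev n)) = Subalgebra.toSubmodule
      (Algebra.adjoin K {y : OqMat (2 * n) | ∃ i j : Fin (2 * n), y = xAII n i j}) := by
  rw [adjoin_xAII, ← (isQSkew_xAII n).span_revLex q_ne_zero (L := (pairListSubtype n).reverse)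
    (List.pairwise_reverse.2 (pairwise_pairListSubtype n))
    (fun p => List.mem_reverse.2 (mem_pairListSubtype p)), ← funext (monoAIIrev_eq n)]

end SkewGenerators

section Comultiplication

namespace IsQMat

variable {F ι κ B : Type*} [Field F] [LinearOrder ι] [LinearOrder κ] [Ring B] [Algebra F B]

lemma transpose {s : F} {T : ι → κ → B} (h : IsQMat s T) : IsQMat s fun i j => T j i where
  row l _ _ hij := h.col l hij
  col l _ _ hij := h.row l hij
  anti hik hjl := (h.anti hjl hik).symm
  main hik hjl := by rw [h.main hjl hik, h.anti hjl hik]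

lemma smul_col {s : F} {T : ι → κ → B} (h : IsQMat s T) (r : κ → F) :
    IsQMat s fun i j => r j • T i j where
  row l i j hij := by
    simp only [smul_mul_assoc, mul_smul_comm, h.row l hij, smul_smul]
    congr 1; ring
  col l i j hij := by
    simp only [smul_mul_assoc, mul_smul_comm, h.col l hij, smul_smul]
    congr 1; ring
  anti hik hjl := by
    simp only [smul_mul_assoc, mul_smul_comm, h.anti hik hjl, smul_smul, mul_comm]
  main hik hjl := by
    simp only [smul_mul_assoc, mul_smul_comm, h.main hik hjl, smul_smul, smul_add]
    congr 2 <;> ring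

lemma map {B' : Type*} [Ring B'] [Algebra F B'] {s : F} {T : ι → κ → B} (h : IsQMat s T)
    (φ : B →ₐ[F] B') : IsQMat s fun i j => φ (T i j) where
  row l i j hij := by rw [← map_mul, h.row l hij, map_smul, map_mul]
  col l i j hij := by rw [← map_mul, h.col l hij, map_smul, map_mul]
  anti hik hjl := by rw [← map_mul, h.anti hik hjl, map_mul]
  main hik hjl := by rw [← map_mul, h.main hik hjl, map_add, map_smul, map_mul, map_mul]

/-- The product of two mutually commuting quantum matrices is a quantum matrix. -/
lemma mul {n : ℕ} {s : F} (hs : s ≠ 0) {T : ι → Fin n → B} {X : Fin n → κ → B}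
    (hT : IsQMat s T) (hX : IsQMat s X) (hTX : ∀ i j k l, Commute (X k l) (T i j)) :
    IsQMat s fun i j => ∑ k, T i k * X k j := by
  have comm : ∀ i j k l, X k l * T i j = T i j * X k l := fun i j k l => hTX i j k l
  have comm_assoc : ∀ i j k l (z : B), X k l * (T i j * z) = T i j * (X k l * z) :=
    fun i j k l z => by rw [← mul_assoc, comm, mul_assoc]
  constructor
  · intro l i j hij
    simp only [Finset.sum_mul_sum, Finset.smul_sum, ← Finset.sum_add_distrib]
    refine sum_sum_eq_of_symm _ _ (fun k => ?_) fun k m hkm => ?_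
    · simp only [mul_assoc, comm, comm_assoc, mul_smul_comm, smul_mul_assoc, smul_smul,
        smul_sub, smul_add, mul_sub, mul_add, hX.row_swap hs _ hij]
      match_scalars <;> field_simp
    · simp only [mul_assoc, comm, comm_assoc, mul_smul_comm, smul_mul_assoc, smul_smul,
        smul_sub, smul_add, mul_sub, mul_add, hX.row_swap hs _ hij, hT.row_swap hs _ hkm,
        hT.row_swap_assoc hs _ hkm, hX.col_swap hs _ hkm, hX.main_swap hkm hij, ← hX.anti hkm
        hij]
      match_scalars <;> field_simp <;> ring
  · intro l i j hij
    simp only [Finset.sum_mul_sum, Finset.smul_sum, ← Finset.sum_add_distrib]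
    refine sum_sum_eq_of_symm _ _ (fun k => ?_) fun k m hkm => ?_
    · simp only [mul_assoc, comm, comm_assoc, mul_smul_comm, smul_mul_assoc, smul_smul,
        smul_sub, smul_add, mul_sub, mul_add, hT.col_swap hs _ hij, hT.col_swap_assoc hs _
        hij]
      match_scalars <;> field_simp
    · simp only [mul_assoc, comm, comm_assoc, mul_smul_comm, smul_mul_assoc, smul_smul,
        smul_sub, smul_add, mul_sub, mul_add, hT.col_swap hs _ hij, hT.col_swap_assoc hs _
        hij, hT.row_swap hs _ hkm, hT.row_swap_assoc hs _ hkm, hX.col_swap hs _ hkm,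
        hT.main_swap hij hkm, hT.main_swap_assoc hij hkm, ← hT.anti hij hkm, hT.anti_assoc hij
        hkm]
      match_scalars <;> field_simp <;> ring
  · intro i i' j j' hi hj
    simp only [Finset.sum_mul_sum, Finset.smul_sum, ← Finset.sum_add_distrib]
    refine sum_sum_eq_of_symm _ _ (fun k => ?_) fun k m hkm => ?_
    · simp only [mul_assoc, comm, comm_assoc, mul_smul_comm, smul_mul_assoc, smul_smul,
        smul_sub, smul_add, mul_sub, mul_add, hT.col_swap hs _ hi, hT.col_swap_assoc hs _ hi,
        hX.row_swap hs _ hj]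
    · simp only [mul_assoc, comm, comm_assoc, mul_smul_comm, smul_mul_assoc, smul_smul,
        smul_sub, smul_add, mul_sub, mul_add, hT.col_swap hs _ hi, hT.col_swap_assoc hs _ hi,
        hX.row_swap hs _ hj, hT.row_swap hs _ hkm, hT.row_swap_assoc hs _ hkm, hX.col_swap hs
        _ hkm, hT.main_swap hi hkm, hT.main_swap_assoc hi hkm, ← hT.anti hi hkm, hT.anti_assoc
        hi hkm, hX.main_swap hkm hj, ← hX.anti hkm hj]
      match_scalars <;> field_simp
  · intro i i' j j' hi hj
    simp only [Finset.sum_mul_sum, Finset.smul_sum, ← Finset.sum_add_distrib]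
    refine sum_sum_eq_of_symm _ _ (fun k => ?_) fun k m hkm => ?_
    · simp only [mul_assoc, comm, comm_assoc, mul_smul_comm, smul_mul_assoc, smul_smul,
        smul_sub, smul_add, mul_sub, mul_add, hT.col_swap hs _ hi, hT.col_swap_assoc hs _ hi,
        hX.row_swap hs _ hj]
      match_scalars <;> field_simp <;> ring
    · simp only [mul_assoc, comm, comm_assoc, mul_smul_comm, smul_mul_assoc, smul_smul,
        smul_sub, smul_add, mul_sub, mul_add, hT.col_swap hs _ hi, hT.col_swap_assoc hs _ hi,
        hX.row_swap hs _ hj, hT.row_swap hs _ hkm, hT.row_swap_assoc hs _ hkm, hX.col_swap hs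
        _ hkm, hT.main_swap hi hkm, hT.main_swap_assoc hi hkm, ← hT.anti hi hkm, hT.anti_assoc
        hi hkm, hX.main_swap hkm hj, ← hX.anti hkm hj]
      match_scalars <;> field_simp <;> ring

end IsQMat

end Comultiplication

section Specialization

open Polynomial in
/-- The rational function `x` is regular at `q = 1` with value `c`. -/
def HasValueAtOne (x : K) (c : ℂ) : Prop :=
  ∃ p r : ℂ[X], r.eval 1 ≠ 0 ∧ x * algebraMap ℂ[X] K r = algebraMap ℂ[X] K p ∧
    c * r.eval 1 = p.eval 1

namespace HasValueAtOne

variable {x y : K} {c d : ℂ}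

lemma add (hx : HasValueAtOne x c) (hy : HasValueAtOne y d) : HasValueAtOne (x + y) (c + d) := by
  obtain ⟨p, r, hr, h1, h2⟩ := hx
  obtain ⟨p', r', hr', h1', h2'⟩ := hy
  refine ⟨p * r' + p' * r, r * r', by simp [hr, hr'], ?_, ?_⟩
  · simp only [map_mul, map_add, ← h1, ← h1']; ring
  · simp only [Polynomial.eval_mul, Polynomial.eval_add, ← h2, ← h2']; ring

lemma mul (hx : HasValueAtOne x c) (hy : HasValueAtOne y d) : HasValueAtOne (x * y) (c * d) := by
  obtain ⟨p, r, hr, h1, h2⟩ := hx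
  obtain ⟨p', r', hr', h1', h2'⟩ := hy
  refine ⟨p * p', r * r', by simp [hr, hr'], ?_, ?_⟩
  · simp only [map_mul, ← h1, ← h1']; ring
  · simp only [Polynomial.eval_mul, ← h2, ← h2']; ring

lemma algebraMap (p : Polynomial ℂ) : HasValueAtOne (algebraMap (Polynomial ℂ) K p) (p.eval 1) :=
  ⟨p, 1, by simp⟩

lemma const (u : ℂ) : HasValueAtOne (RatFunc.C u) u := by
  simpa using algebraMap (Polynomial.C u)

lemma one : HasValueAtOne 1 1 := by simpa using const 1

lemma q_pow (v : ℕ) : HasValueAtOne (q ^ v) 1 := by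
  simpa [q] using algebraMap (Polynomial.X ^ v)

lemma q_inv_pow (v : ℕ) : HasValueAtOne (q⁻¹ ^ v) 1 :=
  ⟨1, Polynomial.X ^ v, by simp, by simp [q, RatFunc.X_ne_zero], by simp⟩

lemma eq_zero (h : HasValueAtOne 0 c) : c = 0 := by
  obtain ⟨p, r, hr, h1, h2⟩ := h
  obtain rfl : p = 0 := by
    have := h1.symm
    rwa [zero_mul, map_eq_zero_iff _ (RatFunc.algebraMap_injective ℂ)] at this
  simpa [hr] using h2

end HasValueAtOne

/-- A relation between a vector space over `ℂ(q)` and `ℂ` behaving like specialization at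
`q = 1` of a functional. -/
structure IsSpecialization {M : Type} [AddCommGroup M] [Module K M] (S : M → ℂ → Prop) :
    Prop where
  add : ∀ {m m' c c'}, S m c → S m' c' → S (m + m') (c + c')
  smul : ∀ {r γ m c}, HasValueAtOne r γ → S m c → S (r • m) (γ * c)
  exists_one : ∃ m, S m 1
  eq_zero : ∀ {c}, S 0 c → c = 0

/-- The operator `f` acts as the scalar `γ` after specialization. -/
def ActsAtOne {M : Type} [AddCommGroup M] [Module K M] (S : M → ℂ → Prop)
    (f : Module.End K M) (γ : ℂ) : Prop :=
  ∀ m c, S m c → S (f m) (γ * c)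

namespace IsSpecialization

variable {M : Type} [AddCommGroup M] [Module K M] {S : M → ℂ → Prop} {f g : Module.End K M}
  {γ δ : ℂ}

lemma map_add (hS : IsSpecialization S) (hf : ActsAtOne S f γ) (hg : ActsAtOne S g δ) :
    ActsAtOne S (f + g) (γ + δ) := fun m c h => by
  rw [add_mul]; exact hS.add (hf m c h) (hg m c h)

lemma map_mul (hf : ActsAtOne S f γ) (hg : ActsAtOne S g δ) :
    ActsAtOne S (f * g) (γ * δ) := fun m c h => by
  rw [mul_assoc]; exact hf _ _ (hg m c h)

lemma map_one : ActsAtOne S (1 : Module.End K M) 1 := fun m c h => by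
  simpa using h

lemma map_smul (hS : IsSpecialization S) {r : K} (hr : HasValueAtOne r γ)
    (hf : ActsAtOne S f δ) : ActsAtOne S (r • f) (γ * δ) := fun m c h => by
  rw [mul_assoc]; exact hS.smul hr (hf m c h)

lemma map_zero (hS : IsSpecialization S) : ActsAtOne S (0 : Module.End K M) 0 := fun m c h => by
  simpa using hS.smul (r := 0) (γ := 0) (by simpa using HasValueAtOne.const 0) h

lemma map_sum (hS : IsSpecialization S) {ι : Type*} (s : Finset ι) {f : ι → Module.End K M}
    {γ : ι → ℂ} (h : ∀ i ∈ s, ActsAtOne S (f i) (γ i)) :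
    ActsAtOne S (∑ i ∈ s, f i) (∑ i ∈ s, γ i) := by
  classical
  induction s using Finset.induction_on with
  | empty => simpa using hS.map_zero
  | insert i s hi ih =>
    rw [Finset.sum_insert hi, Finset.sum_insert hi]
    exact hS.map_add (h i (by simp)) (ih fun j hj => h j (by simp [hj]))

lemma map_pow (hf : ActsAtOne S f γ) (k : ℕ) : ActsAtOne S (f ^ k) (γ ^ k) := by
  induction k with
  | zero => simpa using map_one
  | succ k ih => rw [pow_succ, pow_succ]; exact map_mul ih hf

lemma map_list_prod {ι : Type*} (l : List ι) {f : ι → Module.End K M} {γ : ι → ℂ}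
    (h : ∀ i, ActsAtOne S (f i) (γ i)) :
    ActsAtOne S (l.map f).prod (l.map γ).prod := by
  induction l with
  | nil => simpa using map_one
  | cons i l ih => simpa using map_mul (h i) ih

lemma eq_zero_of_map_zero (hS : IsSpecialization S) (h : ActsAtOne S (0 : Module.End K M) γ) :
    γ = 0 := by
  obtain ⟨m, hm⟩ := hS.exists_one
  exact hS.eq_zero (by simpa using h m 1 hm)

end IsSpecialization

/-- The complex matrix `τ` is the value at `q = 1` of a quantum matrix of operators. -/
def Realizable {N : ℕ} (τ : Matrix (Fin N) (Fin N) ℂ) : Prop :=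
  ∃ (M : Type) (_ : AddCommGroup M) (_ : Module K M) (S : M → ℂ → Prop)
    (T : Fin N → Fin N → Module.End K M), IsSpecialization S ∧ IsQMat q T ∧
      ∀ i j, ActsAtOne S (T i j) (τ i j)

lemma IsQMat.one {F ι B : Type*} [Field F] [LinearOrder ι] [Ring B] [Algebra F B] (s : F) :
    IsQMat s fun i j : ι => if i = j then (1 : B) else 0 where
  row l i j h := by
    split_ifs <;> simp_all
  col l i j h := by
    split_ifs <;> simp_all
  anti hik hjl := by
    split_ifs <;> simp_all
  main {i k j l} hik hjl := by
    have : ¬(k = j ∧ i = l) := fun h => (hik.trans (h.1 ▸ hjl)).ne h.2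
    split_ifs <;> simp_all

lemma realizable_one (N : ℕ) : Realizable (1 : Matrix (Fin N) (Fin N) ℂ) := by
  refine ⟨K, inferInstance, inferInstance, HasValueAtOne, fun i j => if i = j then 1 else 0,
    ⟨fun h h' => h.add h', fun h h' => h.mul h', ⟨1, .one⟩, fun h => h.eq_zero⟩,
    IsQMat.one q, fun i j => ?_⟩
  intro m c hm
  by_cases h : i = j
  · simpa [Matrix.one_apply, h] using hm
  · simpa [Matrix.one_apply, h] using HasValueAtOne.const 0

lemma Realizable.mul_diagonal {N : ℕ} {τ : Matrix (Fin N) (Fin N) ℂ} (h : Realizable τ)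
    (u : Fin N → ℂ) : Realizable (τ * Matrix.diagonal u) := by
  obtain ⟨M, _, _, S, T, hS, hT, hτ⟩ := h
  refine ⟨M, _, _, S, _, hS, hT.smul_col fun j => RatFunc.C (u j), fun i j => ?_⟩
  rw [Matrix.mul_diagonal, mul_comm]
  exact hS.map_smul (.const _) (hτ i j)

/-- A quantum matrix which differs from a diagonal one in a single entry above the diagonal. -/
lemma IsQMat.bidiagonal {F B : Type*} [Field F] [Ring B] [Algebra F B] {N : ℕ} {s : F}
    {c c' : Fin N} (hc : (c : ℕ) + 1 = c') {a b d : B} (hab : a * b = s • (b * a))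
    (hbd : b * d = s • (d * b)) (had : a * d = d * a) :
    IsQMat s fun i j : Fin N => if i = j then (if i = c then a else if i = c' then d else 1)
      else if i = c ∧ j = c' then b else 0 := by
  simp only [Fin.ext_iff]
  set X : Fin N → Fin N → B := fun i j => if (i : ℕ) = j then
    (if (i : ℕ) = c then a else if (i : ℕ) = c' then d else 1)
      else if (i : ℕ) = c ∧ (j : ℕ) = c' then b else 0 with hX
  have hzero : ∀ {i k j l : Fin N}, i < k → j < l → X k j = 0 ∨ X i l = 0 := by
    intro i k j l hik hjl
    rw [Fin.lt_def] at hik hjl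
    by_cases hkj : (k : ℕ) ≤ j
    · right
      simp only [hX]
      rw [if_neg (by omega), if_neg (by omega)]
    · left
      simp only [hX]
      rw [if_neg (by omega), if_neg (by omega)]
  have hcomm : ∀ {i k j l : Fin N}, i < k → j < l → X i j * X k l = X k l * X i j := by
    intro i k j l hik hjl
    rw [Fin.lt_def] at hik hjl
    by_cases hij : (i : ℕ) = j
    · by_cases hkl : (k : ℕ) = l
      · simp only [hX, if_pos hij, if_pos hkl]
        split_ifs <;> first | omega | simp [*]
      · simp only [hX, if_pos hij, if_neg hkl]
        split_ifs <;> first | omega | simp [*]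
    · by_cases hkl : (k : ℕ) = l
      · simp only [hX, if_neg hij, if_pos hkl]
        split_ifs <;> first | omega | simp [*]
      · simp only [hX, if_neg hij, if_neg hkl]
        split_ifs <;> first | omega | simp [*]
  constructor
  · intro l i j hij
    rw [Fin.lt_def] at hij
    simp only [hX]
    split_ifs <;> first | omega | simp [*]
  · intro l i j hij
    rw [Fin.lt_def] at hij
    simp only [hX]
    split_ifs <;> first | omega | simp [*]
  · intro i k j l hik hjl
    rcases hzero hik hjl with h | h <;> simp [h]
  · intro i k j l hik hjl
    rw [hcomm hik hjl]
    rcases hzero hik hjl with h | h <;> simp [h]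

/-- Adjoining a variable: sequences in `M`, of which the `v`-th entry is weighted by `ζ ^ v`. -/
def seqSpecialization {M : Type} (S : M → ℂ → Prop) (ζ : ℂ) (f : ℕ → M) (c : ℂ) : Prop :=
  ∀ v, S (f v) (ζ ^ v * c)

lemma IsSpecialization.seq {M : Type} [AddCommGroup M] [Module K M] {S : M → ℂ → Prop}
    (hS : IsSpecialization S) (ζ : ℂ) : IsSpecialization (seqSpecialization S ζ) where
  add h h' v := by rw [mul_add]; exact hS.add (h v) (h' v)
  smul hr h v := by rw [mul_left_comm]; exact hS.smul hr (h v)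
  exists_one := by
    obtain ⟨m, hm⟩ := hS.exists_one
    exact ⟨fun v => RatFunc.C (ζ ^ v) • m, fun v => hS.smul (.const _) hm⟩
  eq_zero h := hS.eq_zero (by simpa using h 0)

section SequenceOperators

variable (M : Type) [AddCommGroup M] [Module K M]

/-- The shift of sequences. -/
def seqShift : Module.End K (ℕ → M) where
  toFun f v := f (v + 1)
  map_add' _ _ := rfl
  map_smul' _ _ := rfl

/-- The operator multiplying the `v`-th entry by `r ^ v`. -/
def seqScale (r : K) : Module.End K (ℕ → M) where
  toFun f v := r ^ v • f v
  map_add' _ _ := funext fun _ => smul_add _ _ _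
  map_smul' _ _ := funext fun _ => smul_comm _ _ _

variable {M}

/-- Entrywise application of an operator to sequences. -/
def seqMap : Module.End K M →ₐ[K] Module.End K (ℕ → M) :=
  AlgHom.ofLinearMap
    { toFun := fun f => f.compLeft ℕ
      map_add' := fun _ _ => rfl
      map_smul' := fun _ _ => rfl } rfl fun _ _ => rfl

lemma commute_seqShift_seqMap (f : Module.End K M) : Commute (seqShift M) (seqMap f) := rfl

lemma commute_seqScale_seqMap (r : K) (f : Module.End K M) :
    Commute (seqScale M r) (seqMap f) :=
  LinearMap.ext fun g => funext fun v => (map_smul f (r ^ v) (g v)).symm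

end SequenceOperators

lemma Realizable.mul_elementary {N : ℕ} {τ : Matrix (Fin N) (Fin N) ℂ} (h : Realizable τ)
    {c c' : Fin N} (hc : (c : ℕ) + 1 = c') (ζ : ℂ) :
    Realizable (τ * Matrix.transvection c c' ζ) ∧ Realizable (τ * Matrix.transvection c' c ζ) := by
  obtain ⟨M, _, _, S, T, hS, hT, hτ⟩ := h
  have hcc : c ≠ c' := by rintro rfl; omega
  let a := seqScale M q⁻¹
  let b := seqShift M
  let d := seqScale M q
  have hab : a * b = q • (b * a) := by
    ext f v
    change (q⁻¹) ^ v • f (v + 1) = q • (q⁻¹) ^ (v + 1) • f (v + 1)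
    rw [smul_smul, pow_succ', mul_inv_cancel_left₀ q_ne_zero]
  have hbd : b * d = q • (d * b) := by
    ext f v
    change q ^ (v + 1) • f (v + 1) = q • q ^ v • f (v + 1)
    rw [smul_smul, pow_succ']
  have had : a * d = d * a := LinearMap.ext fun f => funext fun v => smul_comm _ _ _
  have hX := IsQMat.bidiagonal (F := K) (s := q) hc hab hbd had
  have hT' := hT.map (seqMap (M := M))
  have hS' := hS.seq ζ
  have hτ' : ∀ i j, ActsAtOne (seqSpecialization S ζ) (seqMap (T i j)) (τ i j) :=
    fun i j f e hf v => by rw [mul_left_comm]; exact hτ i j _ _ (hf v)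
  set X : Fin N → Fin N → Module.End K (ℕ → M) := fun i j =>
    if i = j then (if i = c then a else if i = c' then d else 1)
      else if i = c ∧ j = c' then b else 0 with hXdef
  have hX1 : ∀ i j, ActsAtOne (seqSpecialization S ζ) (X i j) (Matrix.transvection c c' ζ i j) := by
    have ha : ActsAtOne (seqSpecialization S ζ) a 1 := fun f e hf v => by
      rw [mul_left_comm]; exact hS.smul (.q_inv_pow v) (hf v)
    have hd : ActsAtOne (seqSpecialization S ζ) d 1 := fun f e hf v => by
      rw [mul_left_comm]; exact hS.smul (.q_pow v) (hf v)
    have hb : ActsAtOne (seqSpecialization S ζ) b ζ := fun f e hf v => by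
      rw [← mul_assoc, ← pow_succ]; exact hf (v + 1)
    intro i j
    simp only [hXdef, Matrix.transvection, Matrix.add_apply, Matrix.one_apply,
      Matrix.single_apply]
    by_cases hij : i = j
    · subst hij
      have : ¬(c = i ∧ c' = i) := fun h => hcc (h.1.trans h.2.symm)
      simp only [this, if_true, if_false, add_zero]
      split_ifs
      exacts [ha, hd, IsSpecialization.map_one]
    · simp only [hij, if_false, zero_add, @eq_comm _ c, @eq_comm _ c']
      split_ifs
      exacts [hb, hS'.map_zero]
  have hcomm : ∀ i j k l, Commute (X k l) (seqMap (T i j)) := by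
    intro i j k l
    simp only [hXdef]
    split_ifs
    · exact commute_seqScale_seqMap _ _
    · exact commute_seqScale_seqMap _ _
    · exact Commute.one_left _
    · exact commute_seqShift_seqMap _
    · exact Commute.zero_left _
  refine ⟨⟨ℕ → M, _, _, _, _, hS', hT'.mul q_ne_zero hX hcomm, fun i j => ?_⟩,
    ⟨ℕ → M, _, _, _, _, hS', hT'.mul q_ne_zero hX.transpose fun i j k l => hcomm i j l k,
      fun i j => ?_⟩⟩
  · rw [Matrix.mul_apply]
    exact hS'.map_sum _ fun k _ => IsSpecialization.map_mul (hτ' i k) (hX1 k j)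
  · rw [Matrix.mul_apply]
    refine hS'.map_sum _ fun k _ => IsSpecialization.map_mul (hτ' i k) ?_
    have htr : Matrix.transvection c' c ζ k j = Matrix.transvection c c' ζ j k := by
      simp [Matrix.transvection, Matrix.one_apply, Matrix.single_apply, and_comm, eq_comm]
    rw [htr]
    exact hX1 j k

end Specialization

section AllMatrices

open Matrix

lemma transvection_commutator {ι R : Type*} [Fintype ι] [DecidableEq ι] [CommRing R] {i j k : ι}
    (hij : i ≠ j) (hik : i ≠ k) (hkj : k ≠ j) (c : R) :
    transvection i k c * transvection k j 1 * transvection i k (-c) * transvection k j (-1) =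
      transvection i j c := by
  simp only [transvection, mul_add, add_mul, one_mul, mul_one, single_mul_single_same,
    single_mul_single_of_ne _ _ _ _ hij.symm, single_mul_single_of_ne _ _ _ _ hik.symm,
    single_mul_single_of_ne _ _ _ _ hkj.symm]
  simp only [← single_neg, neg_mul, mul_one, mul_neg, add_zero, zero_mul, neg_zero]
  abel

lemma Realizable.mul_transvection_of_natAbs {N : ℕ} (d : ℕ) :
    ∀ {τ : Matrix (Fin N) (Fin N) ℂ} (_ : Realizable τ) {i j : Fin N}
      (_ : (i : ℤ) - (j : ℤ) = d + 1 ∨ (j : ℤ) - (i : ℤ) = d + 1) (c : ℂ),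
      Realizable (τ * transvection i j c) := by
  induction d with
  | zero =>
    intro τ h i j hij c
    rcases hij with hij | hij
    · exact (h.mul_elementary (by omega) c).2
    · exact (h.mul_elementary (by omega) c).1
  | succ d ih =>
    intro τ h i j hij c
    have hi := i.2
    have hj := j.2
    obtain ⟨k, hk⟩ : ∃ k : Fin N, ((i : ℤ) - k = 1 ∧ (k : ℤ) - j = d + 1) ∨
        ((k : ℤ) - i = 1 ∧ (j : ℤ) - k = d + 1) := by
      rcases hij with hij | hij
      · exact ⟨⟨i - 1, by omega⟩, Or.inl (by simp only; omega)⟩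
      · exact ⟨⟨i + 1, by omega⟩, Or.inr (by simp only; omega)⟩
    have adj : ∀ {τ : Matrix (Fin N) (Fin N) ℂ} (_ : Realizable τ) (c : ℂ),
        Realizable (τ * transvection i k c) := fun h c => by
      rcases hk with hk | hk
      · exact (h.mul_elementary (by omega) c).2
      · exact (h.mul_elementary (by omega) c).1
    have hkj : (k : ℤ) - (j : ℤ) = d + 1 ∨ (j : ℤ) - (k : ℤ) = d + 1 := by omega
    rw [← transvection_commutator (k := k) (by rintro rfl; omega) (by rintro rfl; omega)
      (by rintro rfl; omega), ← mul_assoc, ← mul_assoc, ← mul_assoc]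
    exact ih (adj (ih (adj h c) hkj 1) _) hkj _

lemma Realizable.mul_transvection {N : ℕ} {τ : Matrix (Fin N) (Fin N) ℂ} (h : Realizable τ)
    {i j : Fin N} (hij : i ≠ j) (c : ℂ) : Realizable (τ * transvection i j c) := by
  have : (i : ℕ) ≠ j := Fin.val_ne_of_ne hij
  exact h.mul_transvection_of_natAbs (((i : ℤ) - j).natAbs - 1) (by omega) c

/-- Every complex matrix is the value at `q = 1` of a quantum matrix of operators. -/
lemma realizable {N : ℕ} (τ : Matrix (Fin N) (Fin N) ℂ) : Realizable τ := by
  have h : ∀ σ : Matrix (Fin N) (Fin N) ℂ, Realizable σ → Realizable (σ * τ) := by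
    refine Matrix.diagonal_transvection_induction
      (fun τ => ∀ σ : Matrix (Fin N) (Fin N) ℂ, Realizable σ → Realizable (σ * τ)) τ
      (fun D _ σ hσ => hσ.mul_diagonal D)
      (fun t σ hσ => ?_) fun A B hA hB σ hσ => ?_
    · exact hσ.mul_transvection t.hij t.c
    · rw [← mul_assoc]
      exact hB _ (hA _ hσ)
  simpa using h 1 (realizable_one N)

end AllMatrices

section SkewMatrices

/-- The classical counterpart of `xAII`: the entries of `τ J τᵀ`, with `J` the standard symplectic
form. -/
def skewEntry (n : ℕ) (τ : Fin (2 * n) → Fin (2 * n) → ℂ) (i j : Fin (2 * n)) : ℂ :=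
  ∑ k : Fin n, (τ i (c1 n k) * τ j (c2 n k) - τ i (c2 n k) * τ j (c1 n k))

lemma c1_inj {n : ℕ} {k m : Fin n} : c1 n k = c1 n m ↔ k = m := by
  simp [c1, Fin.ext_iff]

lemma c2_inj {n : ℕ} {k m : Fin n} : c2 n k = c2 n m ↔ k = m := by
  simp [c2, Fin.ext_iff]

lemma c1_ne_c2 {n : ℕ} (k m : Fin n) : c1 n k ≠ c2 n m := by
  simp only [c1, c2, Ne, Fin.ext_iff]
  omega

lemma sum_column_indicator {n : ℕ} (j : Fin (2 * n)) :
    ∑ k : Fin n, ((if j = c1 n k then (1 : ℂ) else 0) + if j = c2 n k then 1 else 0) = 1 := by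
  have hj := j.2
  obtain ⟨m, hm⟩ : ∃ m : Fin n, j = c1 n m ∨ j = c2 n m :=
    ⟨⟨j / 2, by omega⟩, by simp only [c1, c2, Fin.ext_iff]; omega⟩
  rw [Finset.sum_add_distrib]
  rcases hm with rfl | rfl
  · simp [c1_inj, c1_ne_c2]
  · simp [c2_inj, (c1_ne_c2 _ _).symm]

lemma exists_column_partner {n : ℕ} (S : Fin (2 * n) → Fin (2 * n) → ℂ) :
    ∃ H : Fin (2 * n) → Fin (2 * n) → ℂ, ∀ i k,
      H i (c1 n k) = S i (c2 n k) ∧ H i (c2 n k) = -S i (c1 n k) := by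
  refine ⟨fun i b => ∑ k : Fin n, ((if b = c1 n k then S i (c2 n k) else 0) +
    if b = c2 n k then -S i (c1 n k) else 0), fun i k => ⟨?_, ?_⟩⟩
  · simp [c1_inj, c1_ne_c2]
  · simp [c2_inj, (c1_ne_c2 _ _).symm]

/-- The coordinate functional `τ ↦ τ i j`. -/
def entryCLM (N : ℕ) (i j : Fin N) : (Fin N → Fin N → ℂ) →L[ℂ] ℂ :=
  (ContinuousLinearMap.proj (φ := fun _ : Fin N => ℂ) j).comp
    (ContinuousLinearMap.proj (φ := fun _ : Fin N => Fin N → ℂ) i)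

lemma entryCLM_apply {N : ℕ} (i j : Fin N) (τ : Fin N → Fin N → ℂ) :
    entryCLM N i j τ = τ i j := rfl

/-- The derivative of `skewEntry n · i j` at `σ`. -/
def skewEntryDeriv (n : ℕ) (σ : Fin (2 * n) → Fin (2 * n) → ℂ) (i j : Fin (2 * n)) :
    (Fin (2 * n) → Fin (2 * n) → ℂ) →L[ℂ] ℂ :=
  ∑ k : Fin n,
    ((σ i (c1 n k) • entryCLM _ j (c2 n k) + σ j (c2 n k) • entryCLM _ i (c1 n k)) -
    (σ i (c2 n k) • entryCLM _ j (c1 n k) + σ j (c1 n k) • entryCLM _ i (c2 n k)))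

lemma hasStrictFDerivAt_skewEntry {n : ℕ} (σ : Fin (2 * n) → Fin (2 * n) → ℂ)
    (i j : Fin (2 * n)) :
    HasStrictFDerivAt (fun τ => skewEntry n τ i j) (skewEntryDeriv n σ i j) σ := by
  have he : ∀ i j : Fin (2 * n),
      HasStrictFDerivAt (fun τ : Fin (2 * n) → Fin (2 * n) → ℂ => τ i j) (entryCLM _ i j) σ :=
    fun i j => (entryCLM _ i j).hasStrictFDerivAt
  simp only [skewEntry, skewEntryDeriv]
  exact HasStrictFDerivAt.fun_sum (u := Finset.univ) fun k _ =>
    ((he i (c1 n k)).fun_mul (he j (c2 n k))).fun_sub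
      ((he i (c2 n k)).fun_mul (he j (c1 n k)))

lemma skewEntryDeriv_apply {n : ℕ} {S H : Fin (2 * n) → Fin (2 * n) → ℂ}
    (hH : ∀ i k, H i (c1 n k) = S i (c2 n k) ∧ H i (c2 n k) = -S i (c1 n k)) (i j : Fin (2 * n)) :
    skewEntryDeriv n (fun i j => if i = j then 1 else 0) i j H =
      S i j - S j i := by
  have h : skewEntryDeriv n (fun i j => if i = j then 1 else 0) i j H =
      (∑ k : Fin n, ((if j = c1 n k then (1 : ℂ) else 0) + if j = c2 n k then 1 else 0)) * S i j -
      (∑ k : Fin n, ((if i = c1 n k then (1 : ℂ) else 0) + if i = c2 n k then 1 else 0)) *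
        S j i := by
    rw [Finset.sum_mul, Finset.sum_mul, ← Finset.sum_sub_distrib]
    simp only [skewEntryDeriv, _root_.sum_apply]
    refine Finset.sum_congr rfl fun k _ => ?_
    simp only [_root_.sub_apply, _root_.add_apply,
      _root_.smul_apply, entryCLM_apply, smul_eq_mul, hH]
    have h1 : ∀ a b c : Fin (2 * n), (if a = c then (1 : ℂ) else 0) * S b c =
        (if a = c then 1 else 0) * S b a := fun a b c => by split_ifs with h <;> simp [h]
    rw [mul_neg, h1, h1, h1, mul_neg, h1]
    ring
  rw [h, sum_column_indicator, sum_column_indicator, one_mul, one_mul]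

/-- A polynomial vanishing on all skew-symmetric matrices `τ J τᵀ` is zero. -/
lemma eq_zero_of_eval_skewEntry {n : ℕ}
    {f : MvPolynomial {p : Fin (2 * n) × Fin (2 * n) // p.1 < p.2} ℂ}
    (hf : ∀ τ, MvPolynomial.eval (fun p => skewEntry n τ p.1.1 p.1.2) f = 0) : f = 0 := by
  let φ : (Fin (2 * n) → Fin (2 * n) → ℂ) →
      ({p : Fin (2 * n) × Fin (2 * n) // p.1 < p.2} → ℂ) :=
    fun τ p => skewEntry n τ p.1.1 p.1.2
  let σ : Fin (2 * n) → Fin (2 * n) → ℂ := fun i j => if i = j then 1 else 0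
  have hφ : HasStrictFDerivAt φ
      (ContinuousLinearMap.pi fun p : {p : Fin (2 * n) × Fin (2 * n) // p.1 < p.2} =>
        skewEntryDeriv n σ p.1.1 p.1.2) σ :=
    hasStrictFDerivAt_pi.2 fun p => hasStrictFDerivAt_skewEntry σ p.1.1 p.1.2
  have hsurj : (ContinuousLinearMap.pi fun p : {p : Fin (2 * n) × Fin (2 * n) // p.1 < p.2} =>
      skewEntryDeriv n σ p.1.1 p.1.2).toLinearMap.range = ⊤ := by
    refine LinearMap.range_eq_top.2 fun y => ?_
    let S : Fin (2 * n) → Fin (2 * n) → ℂ := fun i j => if h : i < j then y ⟨(i, j), h⟩ else 0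
    obtain ⟨H, hH⟩ := exists_column_partner S
    refine ⟨H, funext fun p => ?_⟩
    refine (skewEntryDeriv_apply hH p.1.1 p.1.2).trans ?_
    simp [S, p.2, p.2.le]
  have hrange : Set.range φ ∈ nhds (φ σ) := by
    rw [← hφ.map_nhds_eq_of_surj hsurj]
    exact Filter.range_mem_map
  obtain ⟨ε, hε, hball⟩ := Metric.mem_nhds_iff.1 hrange
  rw [ball_pi _ hε] at hball
  refine MvPolynomial.funext_set (fun p => Metric.ball (φ σ p) ε)
    (fun p => infinite_of_mem_nhds _ (Metric.ball_mem_nhds _ hε)) fun x hx => ?_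
  obtain ⟨τ, rfl⟩ := hball hx
  rw [map_zero]
  exact hf τ

end SkewMatrices

section Independence

lemma exists_smul_eq_algebraMap {ι : Type*} {s : Finset ι} {g : ι → K} {i : ι} (hi : i ∈ s)
    (hgi : g i ≠ 0) : ∃ (r : K) (p : ι → Polynomial ℂ),
      (∀ j ∈ s, algebraMap (Polynomial ℂ) K (p j) = r * g j) ∧ ∃ j ∈ s, (p j).eval 1 ≠ 0 := by
  classical
  let : NormalizedGCDMonoid (Polynomial ℂ) :=
    UniqueFactorizationMonoid.toNormalizedGCDMonoid (Polynomial ℂ)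
  obtain ⟨b, hb⟩ :=
    IsLocalization.exist_integer_multiples (nonZeroDivisors (Polynomial ℂ)) s g
  choose! p hp using hb
  obtain ⟨p', hp', hgcd⟩ := Finset.extract_gcd p ⟨i, hi⟩
  set d := s.gcd p
  have hb0 : algebraMap (Polynomial ℂ) K b ≠ 0 := by
    simp
  have hd0 : algebraMap (Polynomial ℂ) K d ≠ 0 := by
    intro h0
    have h := hp i hi
    rw [hp' i hi, map_mul, h0, zero_mul, Algebra.smul_def] at h
    exact mul_ne_zero hb0 hgi h.symm
  refine ⟨(algebraMap (Polynomial ℂ) K d)⁻¹ * algebraMap (Polynomial ℂ) K b, p', fun j hj => ?_, ?_⟩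
  · have h := hp j hj
    rw [hp' j hj, map_mul, Algebra.smul_def] at h
    rw [mul_assoc, ← h, inv_mul_cancel_left₀ hd0]
  · by_contra! hall
    have hdvd : Polynomial.X - Polynomial.C 1 ∣ s.gcd p' :=
      Finset.dvd_gcd fun j hj => Polynomial.dvd_iff_isRoot.2 (hall j hj)
    rw [hgcd] at hdvd
    exact Polynomial.not_isUnit_X_sub_C 1 (isUnit_of_dvd_one hdvd)

/-- The representation of `𝒪_q(Mat_N)` given by a quantum matrix of operators. -/
lemma IsQMat.exists_algHom {N : ℕ} {B : Type*} [Ring B] [Algebra K B] {T : Fin N → Fin N → B}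
    (h : IsQMat q T) : ∃ Φ : OqMat N →ₐ[K] B, ∀ i j, Φ (tGen i j) = T i j := by
  have hw : ∀ ⦃x y : FreeAlgebra K (Fin N × Fin N)⦄, matRel N x y →
      FreeAlgebra.lift K (fun p : Fin N × Fin N => T p.1 p.2) x =
        FreeAlgebra.lift K (fun p : Fin N × Fin N => T p.1 p.2) y := by
    rintro _ _ (⟨l, i, j, hij⟩ | ⟨l, i, j, hij⟩ | ⟨i, k, j, l, hik, hjl⟩ | ⟨i, k, j, l, hik, hjl⟩)
    · simp [Tg, h.row l hij]
    · simp [Tg, h.col l hij]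
    · simp [Tg, h.anti hik hjl]
    · simp [Tg, h.main hik hjl]
  refine ⟨RingQuot.liftAlgHom K ⟨_, hw⟩, fun i j => ?_⟩
  rw [tGen, RingQuot.liftAlgHom_mkAlgHom_apply, Tg, FreeAlgebra.lift_ι_apply]

lemma actsAtOne_xAII {n : ℕ} {M : Type} [AddCommGroup M] [Module K M] {S : M → ℂ → Prop}
    (hS : IsSpecialization S) {Φ : OqMat (2 * n) →ₐ[K] Module.End K M}
    {τ : Fin (2 * n) → Fin (2 * n) → ℂ} (hΦ : ∀ i j, ActsAtOne S (Φ (tGen i j)) (τ i j))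
    (i j : Fin (2 * n)) : ActsAtOne S (Φ (xAII n i j)) (skewEntry n τ i j) := by
  rw [xAII, map_sum, skewEntry]
  refine hS.map_sum _ fun k _ => ?_
  have hq : HasValueAtOne (-q) (-1) := by simpa [q] using HasValueAtOne.algebraMap (-Polynomial.X)
  have h := hS.map_add (IsSpecialization.map_mul (hΦ i (c1 n k)) (hΦ j (c2 n k)))
    (hS.map_smul hq (IsSpecialization.map_mul (hΦ i (c2 n k)) (hΦ j (c1 n k))))
  rw [map_sub, map_mul, map_smul, map_mul, sub_eq_add_neg, ← neg_smul, sub_eq_add_neg,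
    neg_eq_neg_one_mul (τ i (c2 n k) * τ j (c1 n k))]
  exact h

/-- Monomials in the `x_{ij}` with a fixed order of the factors are linearly independent. -/
lemma linearIndependent_prod_pow_xAII {n : ℕ}
    {L : List {p : Fin (2 * n) × Fin (2 * n) // p.1 < p.2}} (hL : L.Nodup) (hmem : ∀ p, p ∈ L) :
    LinearIndependent K fun m : {p : Fin (2 * n) × Fin (2 * n) // p.1 < p.2} → ℕ =>
      (L.map fun p => xAII n p.1.1 p.1.2 ^ m p).prod := by
  classical
  rw [linearIndependent_iff']
  intro s g hsum i hi
  by_contra hgi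
  obtain ⟨r, p, hp, i₀, hi₀, hpi₀⟩ := exists_smul_eq_algebraMap hi hgi
  let e : ({p : Fin (2 * n) × Fin (2 * n) // p.1 < p.2} → ℕ) ≃ _ :=
    Finsupp.equivFunOnFinite.symm
  let f : MvPolynomial {p : Fin (2 * n) × Fin (2 * n) // p.1 < p.2} ℂ :=
    ∑ m ∈ s, MvPolynomial.monomial (e m) ((p m).eval 1)
  have hf : f = 0 := by
    refine eq_zero_of_eval_skewEntry fun τ => ?_
    obtain ⟨M, _, _, S, T, hS, hT, hτ⟩ := realizable (Matrix.of τ)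
    obtain ⟨Φ, hΦ⟩ := hT.exists_algHom
    have hx := actsAtOne_xAII hS (Φ := Φ) (τ := τ) fun i j => by rw [hΦ]; exact hτ i j
    have hzero : Φ (∑ m ∈ s, algebraMap (Polynomial ℂ) K (p m) •
        (L.map fun p => xAII n p.1.1 p.1.2 ^ m p).prod) = 0 := by
      rw [Finset.sum_congr rfl fun m hm => by rw [hp m hm, mul_smul], ← Finset.smul_sum, hsum,
        smul_zero, map_zero]
    have hact : ActsAtOne S (Φ (∑ m ∈ s, algebraMap (Polynomial ℂ) K (p m) •
        (L.map fun p => xAII n p.1.1 p.1.2 ^ m p).prod))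
        (∑ m ∈ s, (p m).eval 1 * (L.map fun p => skewEntry n τ p.1.1 p.1.2 ^ m p).prod) := by
      rw [map_sum]
      refine hS.map_sum _ fun m _ => ?_
      rw [map_smul, map_list_prod, List.map_map]
      refine hS.map_smul (.algebraMap _) (IsSpecialization.map_list_prod _ fun p => ?_)
      rw [Function.comp_apply, map_pow]
      exact IsSpecialization.map_pow (hx _ _) _
    rw [hzero] at hact
    rw [← hS.eq_zero_of_map_zero hact, map_sum]
    refine Finset.sum_congr rfl fun m _ => ?_
    rw [MvPolynomial.eval_monomial, Finsupp.prod_pow, ← List.prod_toFinset _ hL]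
    congr 2
    ext p
    simp [hmem p]
  refine hpi₀ ?_
  have hcoeff := congrArg (MvPolynomial.coeff (e i₀)) hf
  simpa [f, MvPolynomial.coeff_sum, MvPolynomial.coeff_monomial, hi₀] using hcoeff

lemma nodup_pairListSubtype (n : ℕ) : (pairListSubtype n).Nodup :=
  (pairwise_pairListSubtype n).imp fun h => by rintro rfl; exact lt_irrefl _ h

end Independence

theorem stmt11 (n : ℕ) :
    (LinearIndependent K
      fun m : {p : Fin (2 * n) × Fin (2 * n) // p.1 < p.2} → ℕ => monoAII n m) ∧
    ((Submodule.span K (Set.range (monoAII n)) : Set (OqMat (2 * n))) =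
      (Algebra.adjoin K {y : OqMat (2 * n) | ∃ i j : Fin (2 * n), y = xAII n i j} :
        Set (OqMat (2 * n)))) ∧
    (LinearIndependent K
      fun m : {p : Fin (2 * n) × Fin (2 * n) // p.1 < p.2} → ℕ => monoAIIrev n m) ∧
    ((Submodule.span K (Set.range (monoAIIrev n)) : Set (OqMat (2 * n))) =
      (Algebra.adjoin K {y : OqMat (2 * n) | ∃ i j : Fin (2 * n), y = xAII n i j} :
        Set (OqMat (2 * n)))) := by
  refine ⟨?_, ?_, ?_, ?_⟩
  · simp only [monoAII_eq]
    exact linearIndependent_prod_pow_xAII (nodup_pairListSubtype n) mem_pairListSubtype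
  · rw [span_range_monoAII]
    rfl
  · simp only [monoAIIrev_eq]
    exact linearIndependent_prod_pow_xAII (List.nodup_reverse.2 (nodup_pairListSubtype n))
      fun p => List.mem_reverse.2 (mem_pairListSubtype p)
  · rw [span_range_monoAIIrev]
    rfl
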